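/- arXiv:2502.17655 — 2 statements merged into one kernel-verified Lean document; each statement's English description precedes it below -/
import Mathlib

section
/- For all ε > 0 there exist κ, η > 0 such that the following holds for all δ > 0. Let (𝕋, Y)_δ be δ^η-dense with C_{KT-CW}(𝕋) ≤ δ^{-η} and C_{F-SW}(𝕋) ≤ δ^{-η}. Then |⋃_{T∈𝕋} Y(T)| ≥ κ·δ^{3/2+ε}·(#𝕋)^{1/2}. In particular, Assertion 𝒟(1/2, 0) is true. -/
open MeasureTheory Metric Set
open scoped Classical

noncomputable section

abbrev E3 : Type := EuclideanSpace ℝ (Fin 3)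

/-- The Lebesgue volume of a subset of `ℝ³`, as a real number. -/
def vol (s : Set E3) : ℝ := (MeasureTheory.volume s).toReal

/-- `T` is a `δ`-tube: the closed `δ`-neighbourhood of a line segment of unit length. -/
def IsTube (δ : ℝ) (T : Set E3) : Prop :=
  ∃ x e : E3, ‖e‖ = 1 ∧ T = Metric.cthickening δ (segment ℝ x (x + e))

/-- The common volume of a `δ`-tube (all `δ`-tubes are congruent). -/
def tubeVol (δ : ℝ) : ℝ :=
  vol (Metric.cthickening δ (segment ℝ (0 : E3) (EuclideanSpace.single (0 : Fin 3) (1 : ℝ))))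

/-- Two sets are essentially distinct if their intersection has volume at most half of the
larger of their two volumes. -/
def EssentiallyDistinct (U V : Set E3) : Prop :=
  vol (U ∩ V) ≤ max (vol U) (vol V) / 2

/-- `(𝕋, Y)_δ`: a finite set of pairwise essentially distinct `δ`-tubes contained in the unit
ball, together with a measurable shading `Y T ⊆ T` of each tube. -/
def TubePair (δ : ℝ) (𝕋 : Finset (Set E3)) (Y : Set E3 → Set E3) : Prop :=
  (∀ T ∈ 𝕋, IsTube δ T ∧ T ⊆ Metric.closedBall 0 1 ∧ Y T ⊆ T ∧ MeasurableSet (Y T)) ∧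
    ∀ T ∈ 𝕋, ∀ T' ∈ 𝕋, T ≠ T' → EssentiallyDistinct T T'

/-- The pair `(𝕋, Y)` is `λ`-dense. -/
def ShadingDense (lam : ℝ) (𝕋 : Finset (Set E3)) (Y : Set E3 → Set E3) : Prop :=
  lam * ∑ T ∈ 𝕋, vol T ≤ ∑ T ∈ 𝕋, vol (Y T)

/-- The Katz–Tao Convex Wolff constant of a finite family of `δ`-tubes: the infimum of all
`C > 0` such that every (bounded) convex set `W` contains at most `C·|W|·|T|⁻¹` tubes. -/
def KTCW (δ : ℝ) (𝕋 : Finset (Set E3)) : ℝ :=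
  sInf {C : ℝ | 0 < C ∧ ∀ W : Set E3, Convex ℝ W → Bornology.IsBounded W →
    (Set.ncard {T | T ∈ 𝕋 ∧ T ⊆ W} : ℝ) ≤ C * vol W / tubeVol δ}

/-- A slab: the intersection of the unit ball with the thickened neighbourhood of a plane. -/
def IsSlab (W : Set E3) : Prop :=
  ∃ (H : AffineSubspace ℝ E3) (r : ℝ), 0 < r ∧ (H : Set E3).Nonempty ∧
    Module.finrank ℝ H.direction = 2 ∧
    W = Metric.closedBall 0 1 ∩ Metric.cthickening r (H : Set E3)

/-- The Frostman Slab Wolff constant of a finite family of `δ`-tubes: the infimum of all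
`C > 0` such that every slab `W` contains at most `C·|W|·#𝕋` tubes. -/
def FSW (𝕋 : Finset (Set E3)) : ℝ :=
  sInf {C : ℝ | 0 < C ∧ ∀ W : Set E3, IsSlab W →
    (Set.ncard {T | T ∈ 𝕋 ∧ T ⊆ W} : ℝ) ≤ C * vol W * (𝕋.card : ℝ)}

/-- Assertion `𝒟(σ, ω)`. -/
def AssertD (σ ω : ℝ) : Prop :=
  ∀ ε : ℝ, 0 < ε → ∃ κ : ℝ, 0 < κ ∧ ∃ η : ℝ, 0 < η ∧ ∀ δ : ℝ, 0 < δ →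
    ∀ (𝕋 : Finset (Set E3)) (Y : Set E3 → Set E3),
      TubePair δ 𝕋 Y → ShadingDense (δ ^ η) 𝕋 Y →
      KTCW δ 𝕋 ≤ δ ^ (-η) → FSW 𝕋 ≤ δ ^ (-η) →
      κ * δ ^ (ω + ε) * ((𝕋.card : ℝ) * tubeVol δ) *
          ((𝕋.card : ℝ) * tubeVol δ ^ ((1 : ℝ) / 2)) ^ (-σ)
        ≤ vol (⋃ T ∈ 𝕋, Y T)

/-- Assertion `ℰ(σ, ω)`. -/
def AssertE (σ ω : ℝ) : Prop :=
  ∀ ε : ℝ, 0 < ε → ∃ κ : ℝ, 0 < κ ∧ ∃ η : ℝ, 0 < η ∧ ∀ δ : ℝ, 0 < δ →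
    ∀ (𝕋 : Finset (Set E3)) (Y : Set E3 → Set E3),
      TubePair δ 𝕋 Y → ShadingDense (δ ^ η) 𝕋 Y →
      κ * δ ^ (ω + ε) * (KTCW δ 𝕋)⁻¹ * ((𝕋.card : ℝ) * tubeVol δ) *
          ((KTCW δ 𝕋) ^ (-(3 : ℝ) / 2) * FSW 𝕋 *
            ((𝕋.card : ℝ) * tubeVol δ ^ ((1 : ℝ) / 2))) ^ (-σ)
        ≤ vol (⋃ T ∈ 𝕋, Y T)

/-- A finite family of measurable sets in a finite measure space can be replaced by a finite
weighted set of points, without changing the measure of Boolean combinations. -/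
theorem exists_weighted_points {X κ : Type*} [MeasurableSpace X] [Finite κ] (ν : Measure X)
    [IsFiniteMeasure ν] (F : κ → Set X) (hF : ∀ c, MeasurableSet (F c)) :
    ∃ (P : Finset X) (w : X → ℝ), (∀ p, 0 ≤ w p) ∧
      ∀ A : Set X, (∀ x y, (∀ c, x ∈ F c ↔ y ∈ F c) → x ∈ A → y ∈ A) →
        ∑ p ∈ P with p ∈ A, w p = ν.real A := by
  let Φ : X → Set κ := fun x => {c | x ∈ F c}
  have hfin : (Set.range Φ).Finite := Set.toFinite _
  have hmeas : ∀ s : Set κ, MeasurableSet (Φ ⁻¹' {s}) := by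
    intro s
    have : Φ ⁻¹' {s} = ⋂ c, {x | x ∈ F c ↔ c ∈ s} := by
      ext x
      simp only [Φ, mem_preimage, mem_singleton_iff, mem_iInter, mem_ofPred_eq, Set.ext_iff]
    rw [this]
    have := Fintype.ofFinite κ
    refine MeasurableSet.iInter fun c => ?_
    by_cases hc : c ∈ s
    · simpa [hc] using hF c
    · simp only [hc, iff_false]
      exact (hF c).compl
  choose g hg using fun s : Set.range Φ => s.2
  have := hfin.fintype
  refine ⟨Finset.univ.image g, fun p => ν.real (Φ ⁻¹' {Φ p}), fun p => measureReal_nonneg, ?_⟩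
  intro A hA
  have hAu : A = ⋃ p ∈ (Finset.univ.image g).filter (· ∈ A), Φ ⁻¹' {Φ p} := by
    ext x
    simp only [mem_iUnion, Finset.mem_filter, Finset.mem_image, Finset.mem_univ, true_and,
      mem_preimage, mem_singleton_iff, exists_prop]
    constructor
    · intro hx
      have h1 := hg ⟨Φ x, x, rfl⟩
      refine ⟨g ⟨Φ x, x, rfl⟩, ⟨⟨_, rfl⟩, hA x _ (fun c => ?_) hx⟩, h1.symm⟩
      have := Set.ext_iff.1 h1 c
      exact this.symm
    · rintro ⟨p, ⟨-, hp⟩, h⟩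
      refine hA p x (fun c => ?_) hp
      exact (Set.ext_iff.1 h c).symm
  conv_rhs => rw [hAu]
  rw [measureReal_biUnion_finset]
  · intro p hp q hq hpq
    simp only [Finset.coe_filter, Finset.mem_image, Finset.mem_univ, true_and,
      mem_ofPred_eq] at hp hq
    obtain ⟨⟨s, rfl⟩, -⟩ := hp
    obtain ⟨⟨t, rfl⟩, -⟩ := hq
    refine Set.disjoint_left.2 fun x hx hx' => hpq ?_
    simp only [mem_preimage, mem_singleton_iff] at hx hx'
    have : s = t := Subtype.ext (by rw [← hg s, ← hg t, ← hx, ← hx'])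
    rw [this]
  · intro p _
    exact hmeas _

/-- A finite set with a notion of distance contains a large part which, at some scale `τ ^ k`,
has bounded diameter and is not concentrated around any of its points. -/
theorem exists_broad_subset {ι : Type*} (d : ι → ι → ℝ)
    (hd2 : ∀ i j, d i j ≤ 2) (hsymm : ∀ i j, d i j = d j i)
    (htri : ∀ i j l, d i l ≤ d i j + d j l) {τ : ℝ} (m : ℕ) (S : Finset ι) :
    ∃ k ≤ m, ∃ S' ⊆ S, S.card ≤ 4 ^ m * S'.card ∧
      (∀ i ∈ S', ∀ j ∈ S', d i j ≤ 4 * τ ^ k) ∧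
      (k < m → ∀ i ∈ S', 2 * (S'.filter fun j => d j i ≤ 2 * τ ^ (k + 1)).card ≤ S'.card) := by
  rcases S.eq_empty_or_nonempty with rfl | ⟨i₀, hi₀⟩
  · exact ⟨0, Nat.zero_le _, ∅, by simp⟩
  let Q : ℕ → Prop := fun k =>
    ∃ i ∈ S, S.card ≤ 4 ^ k * (S.filter fun j => d i j ≤ 2 * τ ^ k).card
  have hQ0 : Q 0 := by
    refine ⟨i₀, hi₀, ?_⟩
    have : (S.filter fun j => d i₀ j ≤ 2 * τ ^ 0) = S := by
      apply Finset.filter_true_of_mem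
      intro j _
      simpa using hd2 i₀ j
    rw [this]; simp
  set k := Nat.findGreatest Q m with hk
  have hkm : k ≤ m := Nat.findGreatest_le m
  have hQk : Q k := Nat.findGreatest_spec (Nat.zero_le m) hQ0
  obtain ⟨c, hcS, hc⟩ := hQk
  refine ⟨k, hkm, S.filter fun j => d c j ≤ 2 * τ ^ k, Finset.filter_subset _ _, ?_, ?_, ?_⟩
  · exact hc.trans (Nat.mul_le_mul_right _ (Nat.pow_le_pow_right (by norm_num) hkm))
  · intro i hi j hj
    simp only [Finset.mem_filter] at hi hj
    have := htri i c j
    rw [hsymm i c] at this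
    linarith
  · intro hlt i hi
    have hnot : ¬ Q (k + 1) := Nat.findGreatest_is_greatest (n := m) (P := Q)
      (by rw [← hk]; exact Nat.lt_succ_self k) hlt
    simp only [Q, not_exists, not_and, not_le] at hnot
    have h1 := hnot i (Finset.mem_filter.1 hi).1
    have h2 : ((S.filter fun j => d c j ≤ 2 * τ ^ k).filter
        fun j => d j i ≤ 2 * τ ^ (k + 1)).card
        ≤ (S.filter fun j => d i j ≤ 2 * τ ^ (k + 1)).card := by
      apply Finset.card_le_card
      intro j hj
      simp only [Finset.mem_filter] at hj ⊢
      exact ⟨hj.1.1, by rw [hsymm]; exact hj.2⟩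
    have h3 : 4 ^ k * (4 * (S.filter fun j => d i j ≤ 2 * τ ^ (k + 1)).card)
        < 4 ^ k * (S.filter fun j => d c j ≤ 2 * τ ^ k).card := by
      calc _ = 4 ^ (k + 1) * (S.filter fun j => d i j ≤ 2 * τ ^ (k + 1)).card := by ring
        _ < S.card := h1
        _ ≤ _ := hc
    have h4 := Nat.lt_of_mul_lt_mul_left h3
    omega

/-- The combinatorial form of Wolff's hairbrush argument, on a finite weighted set of points. -/
theorem hairbrush_inequality {P ι : Type*} [Fintype P] [Fintype ι] (w : P → ℝ)
    (hw : ∀ p, 0 ≤ w p) (Y Nr : ι → Finset P) (R : ι → ι → Prop) {A B D ρ : ℝ}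
    (hA : 0 ≤ A) (hB : 0 ≤ B) (hD : 0 ≤ D) (hρ : 0 < ρ)
    (hbroad : ∀ p i, p ∈ Y i → ((Finset.univ.filter fun j => p ∈ Y j).card : ℝ)
      ≤ 2 * ((Finset.univ.filter fun j => p ∈ Y j ∧ R j i).card : ℝ))
    (hinter : ∀ j i, R j i → ∑ p ∈ Y j ∩ Y i, w p ≤ D)
    (hnear : ∀ j i, R j i → ∑ p ∈ Y i ∩ Nr j, w p ≤ ρ / 2)
    (hstems : ∀ p, ((Finset.univ.filter fun j =>
      ∃ i, R j i ∧ (Y j ∩ Y i).Nonempty ∧ p ∈ Y i \ Nr j).card : ℝ) ≤ A)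
    (hbrush : ∀ j i, R j i → (Y j ∩ Y i).Nonempty →
      ∑ l with R j l ∧ (Y j ∩ Y l).Nonempty, ∑ p ∈ (Y i ∩ Y l) \ Nr j, w p ≤ B)
    (hmass : 2 * Fintype.card ι * ρ ≤ ∑ i, ∑ p ∈ Y i, w p) :
    (∑ i, ∑ p ∈ Y i, w p) ^ 2 * ρ ^ 2
      ≤ 64 * (∑ p ∈ Finset.univ.biUnion Y, w p) ^ 2 * (A * B * D) := by
  set I := ∑ i, ∑ p ∈ Y i, w p with hI
  set E := ∑ p ∈ Finset.univ.biUnion Y, w p with hE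
  have hE0 : 0 ≤ E := Finset.sum_nonneg fun p _ => hw p
  let G : ι → Prop := fun i => ρ ≤ ∑ p ∈ Y i, w p
  let n : P → ℝ := fun p => ((Finset.univ.filter fun j => p ∈ Y j).card : ℝ)
  let F : ι → ℝ := fun i => ∑ p ∈ Y i, w p * n p
  let J : ℝ := ∑ i with G i, F i
  let h : ι → ι → ℝ := fun j i => if R j i ∧ G i then ∑ p ∈ Y j ∩ Y i, w p else 0
  have hn0 : ∀ p, 0 ≤ n p := fun p => Nat.cast_nonneg _
  have hh0 : ∀ j i, 0 ≤ h j i := by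
    intro j i
    simp only [h]
    split_ifs
    · exact Finset.sum_nonneg fun p _ => hw p
    · exact le_rfl
  have hhD : ∀ j i, h j i ≤ D := by
    intro j i
    simp only [h]
    split_ifs with hc
    · exact hinter j i hc.1
    · exact hD
  have hhne : ∀ j i, h j i ≠ 0 → R j i ∧ G i ∧ (Y j ∩ Y i).Nonempty := by
    intro j i hne
    simp only [h] at hne
    split_ifs at hne with hc
    · refine ⟨hc.1, hc.2, ?_⟩
      by_contra hcon
      rw [Finset.not_nonempty_iff_eq_empty] at hcon
      simp [hcon] at hne
    · exact absurd rfl hne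
  have hhsum : ∀ i, ∑ j, h j i = if G i then
      ∑ p ∈ Y i, w p * ((Finset.univ.filter fun j => p ∈ Y j ∧ R j i).card : ℝ) else 0 := by
    intro i
    by_cases hG : G i
    · simp only [h, hG, and_true, if_true]
      have : ∀ j, (if R j i then ∑ p ∈ Y j ∩ Y i, w p else 0)
          = ∑ p ∈ Y i, if p ∈ Y j ∧ R j i then w p else 0 := by
        intro j
        by_cases hR : R j i
        · simp only [hR, if_true, and_true]
          rw [← Finset.sum_filter]
          congr 1
          ext p; simp [and_comm]
        · simp [hR]
      simp_rw [this]
      rw [Finset.sum_comm]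
      refine Finset.sum_congr rfl fun p _ => ?_
      rw [← Finset.sum_filter, Finset.sum_const, nsmul_eq_mul, mul_comm]
    · simp [h, hG]
  have hJlow : J / 2 ≤ ∑ j, ∑ i, h j i := by
    rw [Finset.sum_comm]
    simp_rw [hhsum]
    rw [← Finset.sum_filter]
    simp only [J, F]
    rw [Finset.sum_div]
    refine Finset.sum_le_sum fun i _ => ?_
    rw [Finset.sum_div]
    refine Finset.sum_le_sum fun p hp => ?_
    have := mul_le_mul_of_nonneg_left (hbroad p i hp) (hw p)
    simp only [n]
    linarith
  have hJup : ∑ j, ∑ i, h j i ≤ J := by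
    rw [Finset.sum_comm]
    simp_rw [hhsum]
    rw [← Finset.sum_filter]
    refine Finset.sum_le_sum fun i _ => ?_
    refine Finset.sum_le_sum fun p hp => ?_
    refine mul_le_mul_of_nonneg_left ?_ (hw p)
    simp only [n]
    exact_mod_cast Finset.card_le_card (fun j hj => by
      simp only [Finset.mem_filter] at hj ⊢
      exact ⟨hj.1, hj.2.1⟩)
  have hJ0 : 0 ≤ J := Finset.sum_nonneg fun i _ => Finset.sum_nonneg fun p _ =>
    mul_nonneg (hw p) (hn0 p)
  -- the density of the good tubes
  have hIJ : I ^ 2 ≤ 4 * (E * J) := by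
    let f : P → ℝ := fun p => ((Finset.univ.filter fun j => G j ∧ p ∈ Y j).card : ℝ)
    have hf0 : ∀ p, 0 ≤ f p := fun p => Nat.cast_nonneg _
    have hfn : ∀ p, f p ≤ n p := by
      intro p
      simp only [f, n]
      exact_mod_cast Finset.card_le_card (fun j hj => by
        simp only [Finset.mem_filter] at hj ⊢
        exact ⟨hj.1, hj.2.2⟩)
    have swap : ∀ v : P → ℝ, ∑ i with G i, ∑ p ∈ Y i, v p
        = ∑ p ∈ Finset.univ.biUnion Y, v p * f p := by
      intro v
      have h1 : ∀ i, ∑ p ∈ Y i, v p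
          = ∑ p ∈ Finset.univ.biUnion Y, if p ∈ Y i then v p else 0 := by
        intro i
        rw [← Finset.sum_filter]
        congr 1
        ext p
        simp only [Finset.mem_filter, Finset.mem_biUnion, Finset.mem_univ, true_and]
        exact ⟨fun hp => ⟨⟨i, hp⟩, hp⟩, fun hp => hp.2⟩
      simp_rw [h1]
      rw [Finset.sum_comm]
      refine Finset.sum_congr rfl fun p _ => ?_
      rw [← Finset.sum_filter, Finset.filter_filter, Finset.sum_const, nsmul_eq_mul, mul_comm]
    have hI2 : I / 2 ≤ ∑ p ∈ Finset.univ.biUnion Y, w p * f p := by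
      rw [← swap]
      have h1 : I = (∑ i with G i, ∑ p ∈ Y i, w p) + ∑ i with ¬ G i, ∑ p ∈ Y i, w p :=
        (Finset.sum_filter_add_sum_filter_not _ _ _).symm
      have h2 : ∑ i with ¬ G i, ∑ p ∈ Y i, w p ≤ Fintype.card ι * ρ := by
        calc ∑ i with ¬ G i, ∑ p ∈ Y i, w p ≤ ∑ i with ¬ G i, ρ := by
              refine Finset.sum_le_sum fun i hi => ?_
              simp only [Finset.mem_filter, G, not_le] at hi
              exact hi.2.le
          _ ≤ ∑ i : ι, ρ := Finset.sum_le_sum_of_subset_of_nonneg (Finset.filter_subset _ _)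
              fun _ _ _ => hρ.le
          _ = _ := by simp
      linarith
    have hJf : ∑ p ∈ Finset.univ.biUnion Y, w p * f p ^ 2 ≤ J := by
      simp only [J, F]
      rw [swap (fun p => w p * n p)]
      refine Finset.sum_le_sum fun p _ => ?_
      have := mul_le_mul_of_nonneg_left (mul_le_mul_of_nonneg_right (hfn p) (hf0 p)) (hw p)
      nlinarith
    have hCS : (∑ p ∈ Finset.univ.biUnion Y, w p * f p) ^ 2
        ≤ E * ∑ p ∈ Finset.univ.biUnion Y, w p * f p ^ 2 := by
      refine Finset.sum_sq_le_sum_mul_sum_of_sq_le_mul _ (fun p _ => hw p)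
        (fun p _ => mul_nonneg (hw p) (sq_nonneg _)) (fun p _ => le_of_eq (by ring))
    have hI0 : 0 ≤ I := Finset.sum_nonneg fun i _ => Finset.sum_nonneg fun p _ => hw p
    have h3 := mul_le_mul_of_nonneg_left hJf hE0
    have h4 : (I / 2) ^ 2 ≤ (∑ p ∈ Finset.univ.biUnion Y, w p * f p) ^ 2 :=
      pow_le_pow_left₀ (by linarith) hI2 2
    nlinarith
  -- the hairbrush
  let g : ι → P → ℝ := fun j p => ∑ i, if p ∈ Y i \ Nr j then h j i else 0
  have hg1 : ρ * J / 4 ≤ ∑ j, ∑ p, w p * g j p := by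
    have h1 : ∀ j, ∑ p, w p * g j p = ∑ i, h j i * ∑ p ∈ Y i \ Nr j, w p := by
      intro j
      simp only [g, Finset.mul_sum]
      rw [Finset.sum_comm]
      refine Finset.sum_congr rfl fun i _ => ?_
      rw [← Finset.sum_filter_add_sum_filter_not _ (fun p => p ∈ Y i \ Nr j)]
      rw [Finset.sum_eq_zero (s := Finset.univ.filter fun p => ¬ p ∈ Y i \ Nr j), add_zero]
      · rw [Finset.filter_univ_mem]
        refine Finset.sum_congr rfl fun p hp => ?_
        rw [if_pos hp, mul_comm]
      · intro p hp
        rw [if_neg (Finset.mem_filter.1 hp).2, mul_zero]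
    have h2 : ∀ j i, h j i * (ρ / 2) ≤ h j i * ∑ p ∈ Y i \ Nr j, w p := by
      intro j i
      by_cases hne : h j i = 0
      · simp [hne]
      obtain ⟨hR, hG, -⟩ := hhne j i hne
      refine mul_le_mul_of_nonneg_left ?_ (hh0 j i)
      have h3 : ∑ p ∈ Y i ∩ Nr j, w p + ∑ p ∈ Y i \ Nr j, w p = ∑ p ∈ Y i, w p :=
        Finset.sum_inter_add_sum_sdiff _ _ _
      have h4 := hnear j i hR
      have h5 : ρ ≤ ∑ p ∈ Y i, w p := hG
      linarith
    calc ρ * J / 4 = (J / 2) * (ρ / 2) := by ring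
      _ ≤ (∑ j, ∑ i, h j i) * (ρ / 2) := mul_le_mul_of_nonneg_right hJlow (by linarith)
      _ = ∑ j, ∑ i, h j i * (ρ / 2) := by simp_rw [Finset.sum_mul]
      _ ≤ ∑ j, ∑ p, w p * g j p := by
        refine Finset.sum_le_sum fun j _ => ?_
        rw [h1]
        exact Finset.sum_le_sum fun i _ => h2 j i
  let χ : ι → P → ℝ := fun j p => if g j p = 0 then 0 else 1
  have hgne : ∀ j p, g j p ≠ 0 → ∃ i, R j i ∧ (Y j ∩ Y i).Nonempty ∧ p ∈ Y i \ Nr j := by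
    intro j p hne
    obtain ⟨i, -, hi⟩ := Finset.exists_ne_zero_of_sum_ne_zero hne
    by_cases hp : p ∈ Y i \ Nr j
    · rw [if_pos hp] at hi
      obtain ⟨hR, -, hY⟩ := hhne j i hi
      exact ⟨i, hR, hY, hp⟩
    · simp [hp] at hi
  have hg2 : ∑ j, ∑ p, w p * χ j p ≤ E * A := by
    rw [Finset.sum_comm]
    have h1 : ∀ p, ∑ j, w p * χ j p ≤ if p ∈ Finset.univ.biUnion Y then w p * A else 0 := by
      intro p
      split_ifs with hp
      · rw [← Finset.mul_sum]
        refine mul_le_mul_of_nonneg_left ?_ (hw p)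
        refine le_trans ?_ (hstems p)
        rw [← Finset.sum_boole]
        refine Finset.sum_le_sum fun j _ => ?_
        simp only [χ]
        by_cases hne : g j p = 0
        · rw [if_pos hne]; split_ifs <;> norm_num
        · rw [if_neg hne, if_pos (hgne j p hne)]
      · refine le_of_eq (Finset.sum_eq_zero fun j _ => ?_)
        simp only [χ]
        by_cases hne : g j p = 0
        · simp [hne]
        · obtain ⟨i, -, -, hi⟩ := hgne j p hne
          exact absurd (Finset.mem_biUnion.2 ⟨i, Finset.mem_univ _, (Finset.mem_sdiff.1 hi).1⟩) hp
    calc ∑ p, ∑ j, w p * χ j p ≤ ∑ p, if p ∈ Finset.univ.biUnion Y then w p * A else 0 :=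
          Finset.sum_le_sum fun p _ => h1 p
      _ = E * A := by
        rw [← Finset.sum_filter, Finset.filter_univ_mem, hE, Finset.sum_mul]
  have hg3 : ∑ j, ∑ p, w p * g j p ^ 2 ≤ B * (D * J) := by
    have h1 : ∀ j, ∑ p, w p * g j p ^ 2
        = ∑ i, ∑ l, h j i * h j l * ∑ p ∈ (Y i ∩ Y l) \ Nr j, w p := by
      intro j
      have : ∀ p, w p * g j p ^ 2 = ∑ i, ∑ l,
          if p ∈ (Y i ∩ Y l) \ Nr j then h j i * h j l * w p else 0 := by
        intro p
        simp only [g]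
        rw [sq, Finset.sum_mul_sum, Finset.mul_sum]
        refine Finset.sum_congr rfl fun i _ => ?_
        rw [Finset.mul_sum]
        refine Finset.sum_congr rfl fun l _ => ?_
        by_cases h1 : p ∈ Y i <;> by_cases h2 : p ∈ Y l <;> by_cases h3 : p ∈ Nr j <;>
          simp [h1, h2, h3]
        ring
      simp_rw [this]
      rw [Finset.sum_comm]
      refine Finset.sum_congr rfl fun i _ => ?_
      rw [Finset.sum_comm]
      refine Finset.sum_congr rfl fun l _ => ?_
      rw [← Finset.sum_filter, Finset.filter_univ_mem, Finset.mul_sum]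
    have h2 : ∀ j i, h j i ^ 2 *
        (∑ l, if h j l = 0 then 0 else ∑ p ∈ (Y i ∩ Y l) \ Nr j, w p) ≤ B * (D * h j i) := by
      intro j i
      by_cases hne : h j i = 0
      · simp [hne]
      obtain ⟨hR, hG, hYne⟩ := hhne j i hne
      have h3 : (∑ l, if h j l = 0 then 0 else ∑ p ∈ (Y i ∩ Y l) \ Nr j, w p) ≤ B := by
        refine le_trans ?_ (hbrush j i hR hYne)
        rw [Finset.sum_filter]
        refine Finset.sum_le_sum fun l _ => ?_
        by_cases hl : h j l = 0
        · rw [if_pos hl]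
          split_ifs
          · exact Finset.sum_nonneg fun p _ => hw p
          · exact le_rfl
        · obtain ⟨hR', -, hY'⟩ := hhne j l hl
          rw [if_neg hl, if_pos ⟨hR', hY'⟩]
      calc _ ≤ h j i ^ 2 * B := mul_le_mul_of_nonneg_left h3 (sq_nonneg _)
        _ = B * (h j i * h j i) := by ring
        _ ≤ B * (D * h j i) :=
          mul_le_mul_of_nonneg_left (mul_le_mul_of_nonneg_right (hhD j i) (hh0 j i)) hB
    have h4 : ∀ j, ∑ p, w p * g j p ^ 2 ≤ ∑ i, B * (D * h j i) := by
      intro j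
      rw [h1]
      let v : ι → ι → ℝ := fun i l => ∑ p ∈ (Y i ∩ Y l) \ Nr j, w p
      have hv0 : ∀ i l, 0 ≤ v i l := fun i l => Finset.sum_nonneg fun p _ => hw p
      have hvs : ∀ i l, v i l = v l i := fun i l => by simp only [v, Finset.inter_comm]
      have h5 : ∀ i l, h j i * h j l * v i l ≤
          (h j i ^ 2 * (if h j l = 0 then 0 else v i l)
            + h j l ^ 2 * (if h j i = 0 then 0 else v l i)) / 2 := by
        intro i l
        by_cases hi : h j i = 0
        · by_cases hl : h j l = 0 <;> simp [hi, hl]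
        by_cases hl : h j l = 0
        · simp [hi, hl]
        rw [if_neg hi, if_neg hl, hvs l i]
        nlinarith [mul_nonneg (sq_nonneg (h j i - h j l)) (hv0 i l)]
      calc ∑ i, ∑ l, h j i * h j l * v i l
          ≤ ∑ i, ∑ l, (h j i ^ 2 * (if h j l = 0 then 0 else v i l)
            + h j l ^ 2 * (if h j i = 0 then 0 else v l i)) / 2 :=
            Finset.sum_le_sum fun i _ => Finset.sum_le_sum fun l _ => h5 i l
        _ = (∑ i, ∑ l, h j i ^ 2 * (if h j l = 0 then 0 else v i l)
            + ∑ l, ∑ i, h j l ^ 2 * (if h j i = 0 then 0 else v l i)) / 2 := by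
            have hsw : ∑ l, ∑ i, h j l ^ 2 * (if h j i = 0 then 0 else v l i)
                = ∑ i, ∑ l, h j l ^ 2 * (if h j i = 0 then 0 else v l i) := Finset.sum_comm
            refine Eq.trans ?_ (congrArg (fun z => (∑ i, ∑ l,
              h j i ^ 2 * (if h j l = 0 then 0 else v i l) + z) / 2) hsw.symm)
            rw [← Finset.sum_add_distrib, Finset.sum_div]
            refine Finset.sum_congr rfl fun i _ => ?_
            rw [← Finset.sum_add_distrib, Finset.sum_div]
        _ = ∑ i, h j i ^ 2 * ∑ l, (if h j l = 0 then 0 else v i l) := by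
            rw [add_self_div_two]
            simp_rw [Finset.mul_sum]
        _ ≤ _ := Finset.sum_le_sum fun i _ => h2 j i
    calc ∑ j, ∑ p, w p * g j p ^ 2 ≤ ∑ j, ∑ i, B * (D * h j i) :=
          Finset.sum_le_sum fun j _ => h4 j
      _ = B * (D * ∑ j, ∑ i, h j i) := by simp_rw [Finset.mul_sum]
      _ ≤ _ := mul_le_mul_of_nonneg_left (mul_le_mul_of_nonneg_left hJup hD) hB
  have hCS : (∑ j, ∑ p, w p * g j p) ^ 2
      ≤ (∑ j, ∑ p, w p * χ j p) * ∑ j, ∑ p, w p * g j p ^ 2 := by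
    simp_rw [← Fintype.sum_prod_type' (f := fun j p => w p * g j p),
      ← Fintype.sum_prod_type' (f := fun j p => w p * χ j p),
      ← Fintype.sum_prod_type' (f := fun j p => w p * g j p ^ 2)]
    refine Finset.sum_sq_le_sum_mul_sum_of_sq_le_mul _ (fun x _ => ?_)
        (fun x _ => mul_nonneg (hw _) (sq_nonneg _)) (fun x _ => ?_)
    · simp only [χ]; split_ifs
      · simp
      · simpa using hw _
    · simp only [χ]; split_ifs with h0
      · simp [h0]
      · exact le_of_eq (by ring)
  have hfinal : (ρ * J / 4) ^ 2 ≤ (E * A) * (B * (D * J)) :=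
    calc (ρ * J / 4) ^ 2 ≤ (∑ j, ∑ p, w p * g j p) ^ 2 :=
          pow_le_pow_left₀ (by positivity) hg1 2
      _ ≤ _ := hCS
      _ ≤ _ := mul_le_mul hg2 hg3
        (Finset.sum_nonneg fun j _ => Finset.sum_nonneg fun p _ => mul_nonneg (hw _) (sq_nonneg _))
        (mul_nonneg hE0 hA)
  rcases hJ0.eq_or_lt with hJz | hJpos
  · rw [← hJz, mul_zero, mul_zero] at hIJ
    have : I ^ 2 = 0 := le_antisymm hIJ (sq_nonneg _)
    rw [this, zero_mul]
    positivity
  · have h1 : ρ ^ 2 * J ≤ 16 * (E * (A * B * D)) := by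
      have : J * (ρ ^ 2 * J) ≤ J * (16 * (E * (A * B * D))) := by nlinarith
      exact le_of_mul_le_mul_left this hJpos
    calc I ^ 2 * ρ ^ 2 ≤ 4 * (E * J) * ρ ^ 2 := mul_le_mul_of_nonneg_right hIJ (sq_nonneg _)
      _ = 4 * E * (ρ ^ 2 * J) := by ring
      _ ≤ 4 * E * (16 * (E * (A * B * D))) := mul_le_mul_of_nonneg_left h1 (by linarith)
      _ = _ := by ring

theorem exists_frame (u v : E3) (hu : ‖u‖ = 1) :
    ∃ b : OrthonormalBasis (Fin 3) ℝ E3, b 0 = u ∧ inner ℝ (b 2) v = 0 := by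
  have hcard : Module.finrank ℝ E3 = Fintype.card (Fin 3) := by simp
  have hlt : Module.finrank ℝ (Submodule.span ℝ ({u, v} : Set E3)) < Module.finrank ℝ E3 := by
    have h1 : Module.finrank ℝ (Submodule.span ℝ ({u, v} : Set E3)) ≤ 2 := by
      have h2 := finrank_span_finset_le_card (R := ℝ) ({u, v} : Finset E3)
      have h3 : ({u, v} : Finset E3).card ≤ 2 := Finset.card_le_two
      simp only [Finset.coe_insert, Finset.coe_singleton] at h2
      exact h2.trans h3
    rw [hcard]
    simpa using Nat.lt_succ_of_le h1
  have hne : (Submodule.span ℝ ({u, v} : Set E3))ᗮ ≠ ⊥ := by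
    intro hbot
    rw [Submodule.orthogonal_eq_bot_iff] at hbot
    rw [hbot, finrank_top] at hlt
    exact lt_irrefl _ hlt
  obtain ⟨n, hn, hn0⟩ := Submodule.exists_mem_ne_zero_of_ne_bot hne
  have hnu : inner ℝ n u = 0 := by
    rw [real_inner_comm]
    exact (Submodule.mem_orthogonal _ _).1 hn u (Submodule.subset_span (by simp))
  have hnv : inner ℝ n v = 0 := by
    rw [real_inner_comm]
    exact (Submodule.mem_orthogonal _ _).1 hn v (Submodule.subset_span (by simp))
  let f : Fin 3 → E3 := ![u, 0, (‖n‖⁻¹ : ℝ) • n]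
  have hf2 : ‖(‖n‖⁻¹ : ℝ) • n‖ = 1 := norm_smul_inv_norm (𝕜 := ℝ) hn0
  have horth : Orthonormal ℝ (({0, 2} : Set (Fin 3)).domRestrict f) := by
    constructor
    · rintro ⟨i, hi⟩
      rcases hi with rfl | rfl
      · exact hu
      · exact hf2
    · rintro ⟨i, hi⟩ ⟨j, hj⟩ hij
      rcases hi with rfl | rfl <;> rcases hj with rfl | rfl
      · exact absurd rfl hij
      · change inner ℝ u ((‖n‖⁻¹ : ℝ) • n) = 0
        rw [inner_smul_right, real_inner_comm, hnu, mul_zero]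
      · change inner ℝ ((‖n‖⁻¹ : ℝ) • n) u = 0
        rw [inner_smul_left, hnu, mul_zero]
      · exact absurd rfl hij
  obtain ⟨b, hb⟩ := horth.exists_orthonormalBasis_extension_of_card_eq hcard
  refine ⟨b, by simpa [f] using hb 0 (by simp), ?_⟩
  rw [hb 2 (by simp)]
  simp [f, inner_smul_left, hnv]

/-- The box with centre `q`, axes `b` and half side lengths `L`. -/
def frameBox (b : OrthonormalBasis (Fin 3) ℝ E3) (q : E3) (L : Fin 3 → ℝ) : Set E3 :=
  {y | ∀ i, |inner ℝ (b i) (y - q)| ≤ L i}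

theorem volume_frameBox (b : OrthonormalBasis (Fin 3) ℝ E3) (q : E3) {L : Fin 3 → ℝ}
    (hL : ∀ i, 0 ≤ L i) :
    volume (frameBox b q L) = ENNReal.ofReal (8 * (L 0 * L 1 * L 2)) := by
  have hpre : frameBox b q L = (fun y => WithLp.ofLp (b.repr y)) ⁻¹'
      (Icc (fun i => (b.repr q) i - L i) (fun i => (b.repr q) i + L i)) := by
    ext y
    simp only [frameBox, mem_ofPred_eq, mem_preimage, mem_Icc, Pi.le_def, ← forall_and]
    refine forall_congr' fun i => ?_
    rw [inner_sub_right, ← b.repr_apply_apply, ← b.repr_apply_apply, abs_le]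
    constructor <;> rintro ⟨h1, h2⟩ <;> constructor <;> linarith
  have hmp : MeasurePreserving (fun y : E3 => WithLp.ofLp (b.repr y)) volume volume :=
    (PiLp.volume_preserving_ofLp (Fin 3)).comp b.measurePreserving_repr
  rw [hpre, hmp.measure_preimage measurableSet_Icc.nullMeasurableSet, Real.volume_Icc_pi,
    Fin.prod_univ_three, ← ENNReal.ofReal_mul (by linarith [hL 0]),
    ← ENNReal.ofReal_mul (mul_nonneg (by linarith [hL 0]) (by linarith [hL 1]))]
  congr 1
  ring

theorem vol_frameBox (b : OrthonormalBasis (Fin 3) ℝ E3) (q : E3) {L : Fin 3 → ℝ}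
    (hL : ∀ i, 0 ≤ L i) : vol (frameBox b q L) = 8 * (L 0 * L 1 * L 2) := by
  rw [vol, volume_frameBox b q hL, ENNReal.toReal_ofReal]
  have := mul_nonneg (mul_nonneg (hL 0) (hL 1)) (hL 2)
  linarith

theorem convex_frameBox (b : OrthonormalBasis (Fin 3) ℝ E3) (q : E3) (L : Fin 3 → ℝ) :
    Convex ℝ (frameBox b q L) := by
  intro x hx y hy s t hs ht hst i
  have h1 : s • x + t • y - q = s • (x - q) + t • (y - q) := by
    have : q = (s + t) • q := by rw [hst, one_smul]
    conv_lhs => rw [this]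
    module
  rw [h1, inner_add_right, inner_smul_right, inner_smul_right]
  have hx' := abs_le.1 (hx i)
  have hy' := abs_le.1 (hy i)
  have h2 : L i = s * L i + t * L i := by rw [← add_mul, hst, one_mul]
  rw [abs_le]
  constructor <;> nlinarith

theorem isBounded_frameBox (b : OrthonormalBasis (Fin 3) ℝ E3) (q : E3) (L : Fin 3 → ℝ) :
    Bornology.IsBounded (frameBox b q L) := by
  refine (Metric.isBounded_closedBall (x := q) (r := ∑ i, L i)).subset fun y hy => ?_
  rw [mem_closedBall, dist_eq_norm, ← b.sum_repr' (y - q)]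
  refine (norm_sum_le _ _).trans (Finset.sum_le_sum fun i _ => ?_)
  rw [norm_smul, b.norm_eq_one, mul_one]
  exact hy i

theorem vol_mono {s t : Set E3} (h : s ⊆ t) (ht : Bornology.IsBounded t) : vol s ≤ vol t :=
  ENNReal.toReal_mono ht.measure_lt_top.ne (measure_mono h)

/-- The distance between the lines spanned by two unit vectors. -/
def lineDist (u v : E3) : ℝ := min ‖u - v‖ ‖u + v‖

theorem lineDist_nonneg (u v : E3) : 0 ≤ lineDist u v :=
  le_min (norm_nonneg _) (norm_nonneg _)

theorem lineDist_comm (u v : E3) : lineDist u v = lineDist v u := by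
  rw [lineDist, lineDist, norm_sub_rev, add_comm]

theorem lineDist_triangle (u v z : E3) : lineDist u z ≤ lineDist u v + lineDist v z := by
  simp only [lineDist]
  have h1 : ‖u - z‖ ≤ ‖u - v‖ + ‖v - z‖ := by
    simpa using norm_add_le (u - v) (v - z)
  have h2 : ‖u + z‖ ≤ ‖u - v‖ + ‖v + z‖ := by
    have := norm_add_le (u - v) (v + z)
    rwa [show u - v + (v + z) = u + z by abel] at this
  have h3 : ‖u + z‖ ≤ ‖u + v‖ + ‖v - z‖ := by
    have := norm_sub_le (u + v) (v - z)
    rwa [show u + v - (v - z) = u + z by abel] at this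
  have h4 : ‖u - z‖ ≤ ‖u + v‖ + ‖v + z‖ := by
    have := norm_sub_le (u + v) (v + z)
    rwa [show u + v - (v + z) = u - z by abel] at this
  rcases min_choice ‖u - v‖ ‖u + v‖ with h | h <;> rcases min_choice ‖v - z‖ ‖v + z‖ with h' | h' <;>
    rw [h, h']
  · exact (min_le_left _ _).trans h1
  · exact (min_le_right _ _).trans h2
  · exact (min_le_right _ _).trans h3
  · exact (min_le_left _ _).trans h4

theorem lineDist_le_two {u v : E3} (hu : ‖u‖ = 1) (hv : ‖v‖ = 1) : lineDist u v ≤ 2 := by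
  refine (min_le_left _ _).trans ((norm_sub_le _ _).trans ?_)
  rw [hu, hv]; norm_num

theorem abs_inner_le_lineDist {u v n : E3} (hn : ‖n‖ = 1) (h : inner ℝ n v = 0) :
    |inner ℝ n u| ≤ lineDist u v := by
  refine le_min ?_ ?_
  · have := abs_real_inner_le_norm n (u - v)
    rwa [inner_sub_right, h, sub_zero, hn, one_mul] at this
  · have := abs_real_inner_le_norm n (u + v)
    rwa [inner_add_right, h, add_zero, hn, one_mul] at this

/-- The component of `x` orthogonal to the unit vector `e`. -/
def perpPart (e x : E3) : E3 := x - inner ℝ e x • e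

theorem perpPart_add (e x y : E3) : perpPart e (x + y) = perpPart e x + perpPart e y := by
  simp only [perpPart, inner_add_right]; module

theorem perpPart_smul (e x : E3) (t : ℝ) : perpPart e (t • x) = t • perpPart e x := by
  simp only [perpPart, inner_smul_right]; module

theorem perpPart_self {e : E3} (he : ‖e‖ = 1) : perpPart e e = 0 := by
  simp [perpPart, he]

theorem norm_perpPart_le {e : E3} (he : ‖e‖ = 1) (x : E3) : ‖perpPart e x‖ ≤ ‖x‖ := by
  have h : ‖perpPart e x‖ ^ 2 ≤ ‖x‖ ^ 2 := by
    rw [perpPart, norm_sub_sq_real, inner_smul_right, norm_smul, he, mul_one, Real.norm_eq_abs,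
      sq_abs, real_inner_comm e x]
    nlinarith [sq_nonneg (inner ℝ e x)]
  exact le_of_sq_le_sq h (norm_nonneg _)

theorem norm_perpPart_le_lineDist {u e : E3} (he : ‖e‖ = 1) :
    ‖perpPart e u‖ ≤ lineDist u e := by
  refine le_min ?_ ?_
  · have h : perpPart e u = perpPart e (u - e) := by
      conv_lhs => rw [← sub_add_cancel u e, perpPart_add, perpPart_self he, add_zero]
    rw [h]; exact norm_perpPart_le he _
  · have h : perpPart e u = perpPart e (u + e) := by
      rw [perpPart_add, perpPart_self he, add_zero]
    rw [h]; exact norm_perpPart_le he _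

/-- The sine of the angle controls the distance between lines. -/
theorem lineDist_le_two_mul_norm_perpPart {u e : E3} (hu : ‖u‖ = 1) (he : ‖e‖ = 1) :
    lineDist u e ≤ 2 * ‖perpPart e u‖ := by
  have h0 : ‖perpPart e u‖ ^ 2 = 1 - (inner ℝ e u) ^ 2 := by
    rw [perpPart, norm_sub_sq_real, inner_smul_right, norm_smul, he, mul_one, Real.norm_eq_abs,
      sq_abs, real_inner_comm e u, hu]
    ring
  have h1 : ‖u - e‖ ^ 2 = 2 - 2 * inner ℝ e u := by
    rw [norm_sub_sq_real, hu, he, real_inner_comm]; ring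
  have h2 : ‖u + e‖ ^ 2 = 2 + 2 * inner ℝ e u := by
    rw [norm_add_sq_real, hu, he, real_inner_comm]; ring
  have hle : |inner ℝ e u| ≤ 1 := by
    have := abs_real_inner_le_norm e u
    rwa [hu, he, mul_one] at this
  rw [abs_le] at hle
  refine le_of_sq_le_sq ?_ (by positivity)
  rcases le_total 0 (inner ℝ e u) with hp | hp
  · refine (pow_le_pow_left₀ (lineDist_nonneg _ _) (min_le_left _ _) 2).trans ?_
    rw [h1, mul_pow, h0]; nlinarith
  · refine (pow_le_pow_left₀ (lineDist_nonneg _ _) (min_le_right _ _) 2).trans ?_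
    rw [h2, mul_pow, h0]; nlinarith

/-- The `δ`-neighbourhood of the segment from `a` to `a + e`, in parametric form. -/
def segTube (δ : ℝ) (a e : E3) : Set E3 :=
  {x | ∃ s : ℝ, 0 ≤ s ∧ s ≤ 1 ∧ ‖x - (a + s • e)‖ ≤ δ}

theorem cthickening_segment_eq {δ : ℝ} (hδ : 0 ≤ δ) (a e : E3) :
    Metric.cthickening δ (segment ℝ a (a + e)) = segTube δ a e := by
  have hc : IsCompact (segment ℝ a (a + e)) := by
    rw [segment_eq_image']
    exact isCompact_Icc.image (by fun_prop)
  rw [hc.cthickening_eq_biUnion_closedBall hδ, segment_eq_image']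
  ext x
  simp only [add_sub_cancel_left, mem_iUnion, mem_image, exists_prop, mem_closedBall,
    dist_eq_norm, segTube, mem_ofPred_eq, mem_Icc]
  constructor
  · rintro ⟨y, ⟨s, ⟨h0, h1⟩, rfl⟩, h⟩
    exact ⟨s, h0, h1, h⟩
  · rintro ⟨s, h0, h1, h⟩
    exact ⟨_, ⟨s, ⟨h0, h1⟩, rfl⟩, h⟩

theorem base_mem_segTube {δ : ℝ} (hδ : 0 ≤ δ) (a e : E3) : a ∈ segTube δ a e :=
  ⟨0, le_rfl, zero_le_one, by simpa using hδ⟩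

theorem exists_sub_smul_le {δ : ℝ} {a e x y : E3} (hx : x ∈ segTube δ a e)
    (hy : y ∈ segTube δ a e) : ∃ t : ℝ, |t| ≤ 1 ∧ ‖x - y - t • e‖ ≤ 2 * δ := by
  obtain ⟨s, hs0, hs1, hs⟩ := hx
  obtain ⟨t, ht0, ht1, ht⟩ := hy
  refine ⟨s - t, by rw [abs_le]; constructor <;> linarith, ?_⟩
  have : x - y - (s - t) • e = (x - (a + s • e)) - (y - (a + t • e)) := by module
  rw [this]
  exact (norm_sub_le _ _).trans (by linarith)

theorem exists_sub_base_smul_le {δ : ℝ} {a e x : E3} (hx : x ∈ segTube δ a e) :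
    ∃ t : ℝ, |t| ≤ 1 ∧ ‖x - a - t • e‖ ≤ δ := by
  obtain ⟨s, hs0, hs1, hs⟩ := hx
  refine ⟨s, by rw [abs_le]; constructor <;> linarith, ?_⟩
  rwa [sub_sub]

theorem abs_inner_le_of_norm_sub_smul_le {n e z : E3} (hn : ‖n‖ = 1) {t c : ℝ} (ht : |t| ≤ 1)
    (hz : ‖z - t • e‖ ≤ c) : |inner ℝ n z| ≤ |inner ℝ n e| + c := by
  have h1 : inner ℝ n z = t * inner ℝ n e + inner ℝ n (z - t • e) := by
    rw [inner_sub_right, inner_smul_right]; ring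
  have h2 := abs_real_inner_le_norm n (z - t • e)
  rw [hn, one_mul] at h2
  rw [h1]
  refine (abs_add_le _ _).trans (add_le_add ?_ (h2.trans hz))
  rw [abs_mul]
  exact mul_le_of_le_one_left (abs_nonneg _) ht

theorem abs_inner_sub_le {δ : ℝ} {a e x y n : E3} (hn : ‖n‖ = 1) (hx : x ∈ segTube δ a e)
    (hy : y ∈ segTube δ a e) : |inner ℝ n (x - y)| ≤ |inner ℝ n e| + 2 * δ := by
  obtain ⟨t, ht, h⟩ := exists_sub_smul_le hx hy
  exact abs_inner_le_of_norm_sub_smul_le hn ht h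

theorem abs_inner_sub_base_le {δ : ℝ} {a e x n : E3} (hn : ‖n‖ = 1) (hx : x ∈ segTube δ a e) :
    |inner ℝ n (x - a)| ≤ |inner ℝ n e| + δ := by
  obtain ⟨t, ht, h⟩ := exists_sub_base_smul_le hx
  exact abs_inner_le_of_norm_sub_smul_le hn ht h

theorem inner_frame_eq_zero (b : OrthonormalBasis (Fin 3) ℝ E3) {i j : Fin 3} (h : i ≠ j) :
    inner ℝ (b i) (b j) = 0 := b.orthonormal.2 h

theorem isBounded_segTube (δ : ℝ) (a e : E3) : Bornology.IsBounded (segTube δ a e) := by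
  refine (Metric.isBounded_closedBall (x := a) (r := δ + ‖e‖)).subset ?_
  rintro x ⟨s, hs0, hs1, hs⟩
  rw [mem_closedBall, dist_eq_norm]
  have : x - a = (x - (a + s • e)) + s • e := by abel
  rw [this]
  refine (norm_add_le _ _).trans (add_le_add hs ?_)
  rw [norm_smul, Real.norm_of_nonneg hs0]
  exact mul_le_of_le_one_left (norm_nonneg _) hs1

theorem vol_segTube_le {δ : ℝ} (hδ : 0 < δ) (hδ1 : δ ≤ 1 / 2) (a : E3) {e : E3}
    (he : ‖e‖ = 1) : vol (segTube δ a e) ≤ 12 * δ ^ 2 := by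
  obtain ⟨b, hb, -⟩ := exists_frame e 0 he
  have hL : ∀ i, 0 ≤ (![3 / 2, δ, δ] : Fin 3 → ℝ) i := by
    intro i; fin_cases i <;> simp <;> linarith
  have hsub : segTube δ a e ⊆ frameBox b a ![3 / 2, δ, δ] := by
    intro x hx i
    have h := abs_inner_sub_base_le (b.norm_eq_one i) hx
    rw [← hb] at h
    fin_cases i
    · have : inner ℝ (b 0) (b 0) = 1 := by simp
      simp only [Fin.zero_eta] at h ⊢
      rw [this, abs_one] at h
      simp; linarith
    · have := inner_frame_eq_zero b (i := 1) (j := 0) (by decide)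
      simp only [Fin.mk_one] at h ⊢
      rw [this, abs_zero, zero_add] at h
      simpa using h
    · have := inner_frame_eq_zero b (i := 2) (j := 0) (by decide)
      simp only [Fin.reduceFinMk] at h ⊢
      rw [this, abs_zero, zero_add] at h
      simpa using h
  refine (vol_mono hsub (isBounded_frameBox _ _ _)).trans ?_
  rw [vol_frameBox _ _ hL]
  simp; nlinarith

theorem le_vol_segTube {δ : ℝ} (hδ : 0 < δ) (a : E3) {e : E3}
    (he : ‖e‖ = 1) : δ ^ 2 ≤ vol (segTube δ a e) := by
  obtain ⟨b, hb, -⟩ := exists_frame e 0 he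
  have hL : ∀ i, 0 ≤ (![1 / 2, δ / 2, δ / 2] : Fin 3 → ℝ) i := by
    intro i; fin_cases i <;> simp <;> linarith
  have hsub : frameBox b (a + (1 / 2 : ℝ) • e) ![1 / 2, δ / 2, δ / 2] ⊆ segTube δ a e := by
    intro x hx
    set z := x - (a + (1 / 2 : ℝ) • e) with hz
    have h0 := hx 0
    have h1 := hx 1
    have h2 := hx 2
    rw [← hz] at h0 h1 h2
    simp only [Matrix.cons_val_zero, Matrix.cons_val_one, Matrix.cons_val] at h0 h1 h2
    refine ⟨1 / 2 + inner ℝ (b 0) z, by linarith [(abs_le.1 h0).1], by linarith [(abs_le.1 h0).2],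
      ?_⟩
    have h3 : x - (a + (1 / 2 + inner ℝ (b 0) z) • e)
        = inner ℝ (b 1) z • b 1 + inner ℝ (b 2) z • b 2 := by
      have h4 := b.sum_repr' z
      rw [Fin.sum_univ_three] at h4
      have h5 : x - (a + (1 / 2 + inner ℝ (b 0) z) • e) = z - inner ℝ (b 0) z • b 0 := by
        rw [hz, ← hb]; module
      rw [h5]
      nth_rewrite 1 [← h4]
      abel
    rw [h3]
    refine (norm_add_le _ _).trans ?_
    rw [norm_smul, norm_smul, b.norm_eq_one, b.norm_eq_one, Real.norm_eq_abs, Real.norm_eq_abs]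
    linarith
  refine le_trans ?_ (vol_mono hsub (isBounded_segTube _ _ _))
  rw [vol_frameBox _ _ hL]
  simp; nlinarith

/-- The part of a tube close to a line transverse to it is short. -/
theorem vol_segTube_inter_near_le {δ r : ℝ} (hδ : 0 < δ) (hr : δ ≤ r) {a e a₀ e₀ : E3}
    (he : ‖e‖ = 1) (he₀ : ‖e₀‖ = 1) (hd : 0 < lineDist e e₀) :
    vol (segTube δ a e ∩ {x | ‖perpPart e₀ (x - a₀)‖ ≤ r}) ≤ 256 * δ ^ 2 * r / lineDist e e₀ := by
  have hr0 : 0 < r := hδ.trans_le hr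
  rcases Set.eq_empty_or_nonempty (segTube δ a e ∩ {x | ‖perpPart e₀ (x - a₀)‖ ≤ r}) with
    h | ⟨y₀, hy₀, hy₀'⟩
  · rw [h]; simp only [vol, measure_empty, ENNReal.toReal_zero]; positivity
  obtain ⟨b, hb, -⟩ := exists_frame e 0 he
  have hL : ∀ i, 0 ≤ (![8 * r / lineDist e e₀, 2 * δ, 2 * δ] : Fin 3 → ℝ) i := by
    intro i; fin_cases i
    · simp; positivity
    · simp; positivity
    · simp; positivity
  have hsub : segTube δ a e ∩ {x | ‖perpPart e₀ (x - a₀)‖ ≤ r}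
      ⊆ frameBox b y₀ ![8 * r / lineDist e e₀, 2 * δ, 2 * δ] := by
    rintro y ⟨hy, hy'⟩ i
    have h := abs_inner_sub_le (b.norm_eq_one i) hy hy₀
    rw [← hb] at h
    fin_cases i
    · clear h
      simp only [Fin.zero_eta, Matrix.cons_val_zero]
      rw [hb]
      obtain ⟨t, -, ht⟩ := exists_sub_smul_le hy hy₀
      set z := y - y₀ with hz
      have hw : ‖perpPart e z‖ ≤ 2 * δ := by
        have : perpPart e z = perpPart e (z - t • e) := by
          conv_lhs => rw [← sub_add_cancel z (t • e), perpPart_add, perpPart_smul,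
            perpPart_self he, smul_zero, add_zero]
        rw [this]; exact (norm_perpPart_le he _).trans ht
      have hp : ‖perpPart e₀ z‖ ≤ 2 * r := by
        have : perpPart e₀ z = perpPart e₀ (y - a₀) + (-1 : ℝ) • perpPart e₀ (y₀ - a₀) := by
          rw [← perpPart_smul, ← perpPart_add, hz]; congr 1; module
        rw [this]
        refine (norm_add_le _ _).trans ?_
        rw [norm_smul]
        simp only [norm_neg, norm_one, one_mul]
        have h1 : ‖perpPart e₀ (y - a₀)‖ ≤ r := hy'
        have h2 : ‖perpPart e₀ (y₀ - a₀)‖ ≤ r := hy₀'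
        linarith
      have hdec : (inner ℝ e z : ℝ) • perpPart e₀ e = perpPart e₀ z - perpPart e₀ (perpPart e z) := by
        have h1 : z = (inner ℝ e z : ℝ) • e + perpPart e z := by simp [perpPart]
        have h2 : perpPart e₀ z
            = (inner ℝ e z : ℝ) • perpPart e₀ e + perpPart e₀ (perpPart e z) := by
          rw [← perpPart_smul, ← perpPart_add, ← h1]
        rw [h2]; abel
      have hn : |inner ℝ e z| * ‖perpPart e₀ e‖ ≤ 4 * r := by
        rw [← Real.norm_eq_abs, ← norm_smul, hdec]
        refine (norm_sub_le _ _).trans ?_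
        have := (norm_perpPart_le he₀ (perpPart e z)).trans hw
        linarith
      rw [le_div_iff₀ hd]
      have h3 := lineDist_le_two_mul_norm_perpPart he he₀
      nlinarith [mul_le_mul_of_nonneg_left h3 (abs_nonneg (inner ℝ e z : ℝ))]
    · have := inner_frame_eq_zero b (i := 1) (j := 0) (by decide)
      simp only [Fin.mk_one] at h ⊢
      rw [this, abs_zero, zero_add] at h
      simpa using h
    · have := inner_frame_eq_zero b (i := 2) (j := 0) (by decide)
      simp only [Fin.reduceFinMk] at h ⊢
      rw [this, abs_zero, zero_add] at h
      simpa using h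
  refine (vol_mono hsub (isBounded_frameBox _ _ _)).trans (le_of_eq ?_)
  rw [vol_frameBox _ _ hL]
  simp only [Matrix.cons_val_zero, Matrix.cons_val_one, Matrix.cons_val]
  ring

theorem segTube_subset_near {δ : ℝ} {a e : E3} (he : ‖e‖ = 1) :
    segTube δ a e ⊆ {x | ‖perpPart e (x - a)‖ ≤ δ} := by
  intro x hx
  obtain ⟨t, -, ht⟩ := exists_sub_base_smul_le hx
  have : perpPart e (x - a) = perpPart e (x - a - t • e) := by
    conv_lhs => rw [← sub_add_cancel (x - a) (t • e), perpPart_add, perpPart_smul,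
      perpPart_self he, smul_zero, add_zero]
  simp only [mem_ofPred_eq]
  rw [this]
  exact (norm_perpPart_le he _).trans ht

theorem measurableSet_near (a e : E3) (r : ℝ) :
    MeasurableSet {x : E3 | ‖perpPart e (x - a)‖ ≤ r} := by
  apply IsClosed.measurableSet
  apply isClosed_le
  · unfold perpPart; fun_prop
  · fun_prop

/-- Tubes meeting a common tube at small angle lie in a common slab. -/
theorem exists_slab {r : ℝ} (hr : 0 < r) (a : E3) {n : E3} (hn : ‖n‖ = 1) :
    ∃ W : Set E3, IsSlab W ∧ (∀ x ∈ Metric.closedBall (0 : E3) 1, |inner ℝ n (x - a)| ≤ r → x ∈ W) ∧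
      vol W ≤ 16 * r := by
  let H : AffineSubspace ℝ E3 := AffineSubspace.mk' a (Submodule.span ℝ {n})ᗮ
  have hH : ∀ x, x ∈ H ↔ inner ℝ n (x - a) = 0 := by
    intro x
    rw [AffineSubspace.mem_mk', Submodule.mem_orthogonal_singleton_iff_inner_right, vsub_eq_sub]
  refine ⟨Metric.closedBall 0 1 ∩ Metric.cthickening r (H : Set E3),
    ⟨H, r, hr, ⟨a, AffineSubspace.self_mem_mk' _ _⟩, ?_, rfl⟩, ?_, ?_⟩
  · rw [AffineSubspace.direction_mk']
    have h1 := Submodule.finrank_add_finrank_orthogonal (Submodule.span ℝ {n})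
    rw [finrank_span_singleton (by rintro rfl; simp at hn)] at h1
    have h2 : Module.finrank ℝ E3 = 3 := by simp
    omega
  · intro x hx h
    refine ⟨hx, Metric.mem_cthickening_of_dist_le x (x - (inner ℝ n (x - a) : ℝ) • n) r _ ?_ ?_⟩
    · change x - (inner ℝ n (x - a) : ℝ) • n ∈ H
      rw [hH, sub_right_comm, inner_sub_right, inner_smul_right, real_inner_self_eq_norm_sq, hn]
      ring
    · rw [dist_eq_norm, sub_sub_cancel, norm_smul, hn, mul_one]
      exact h
  · obtain ⟨b, hb, -⟩ := exists_frame n 0 hn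
    have hL : ∀ i, 0 ≤ (![2 * r, 1, 1] : Fin 3 → ℝ) i := by
      intro i; fin_cases i <;> simp [hr.le]
    let c : E3 := (inner ℝ n a : ℝ) • n
    have hsub : Metric.closedBall 0 1 ∩ Metric.cthickening r (H : Set E3)
        ⊆ frameBox b c ![2 * r, 1, 1] := by
      rintro x ⟨hx, hx'⟩ i
      rw [mem_closedBall, dist_zero_right] at hx
      have hg : ∀ j, j ≠ 0 → |inner ℝ (b j) (x - c)| ≤ 1 := by
        intro j hj
        have h1 : inner ℝ (b j) c = 0 := by
          simp only [c]
          rw [inner_smul_right, ← hb, inner_frame_eq_zero b hj, mul_zero]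
        rw [inner_sub_right, h1, sub_zero]
        refine (abs_real_inner_le_norm _ _).trans ?_
        rw [b.norm_eq_one, one_mul]; exact hx
      fin_cases i
      · simp only [Fin.zero_eta, Matrix.cons_val_zero]
        have h2 := Metric.cthickening_subset_thickening' (δ₂ := 2 * r) (by linarith) (by linarith)
          (H : Set E3) hx'
        rw [Metric.mem_thickening_iff] at h2
        obtain ⟨z, hz, hxz⟩ := h2
        have hz' := (hH z).1 hz
        rw [dist_eq_norm] at hxz
        have h3 : inner ℝ n (x - c) = inner ℝ n (x - z) := by
          simp only [c]
          rw [inner_sub_right] at hz'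
          rw [inner_sub_right, inner_sub_right, inner_smul_right, real_inner_self_eq_norm_sq, hn]
          linarith
        rw [hb, h3]
        refine (abs_real_inner_le_norm _ _).trans ?_
        rw [hn, one_mul]; exact hxz.le
      · simpa using hg 1 (by decide)
      · simpa using hg 2 (by decide)
    refine (vol_mono hsub (isBounded_frameBox _ _ _)).trans (le_of_eq ?_)
    rw [vol_frameBox _ _ hL]
    simp; ring

theorem abs_inner_chain_le {δ α : ℝ} {a e a₁ e₁ a₂ e₂ n p q x : E3} (hn : ‖n‖ = 1)
    (hne : inner ℝ n e = 0) (hp : p ∈ segTube δ a e) (hp₁ : p ∈ segTube δ a₁ e₁)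
    (hq₁ : q ∈ segTube δ a₁ e₁) (hq₂ : q ∈ segTube δ a₂ e₂) (hx : x ∈ segTube δ a₂ e₂)
    (h₁ : lineDist e₁ e ≤ α) (h₂ : lineDist e₂ e ≤ 2 * α) :
    |inner ℝ n (x - a)| ≤ 3 * α + 5 * δ := by
  have h3 := abs_inner_sub_base_le hn hp
  rw [hne, abs_zero, zero_add] at h3
  have h4 := abs_inner_sub_le hn hq₁ hp₁
  have h5 := abs_inner_sub_le hn hx hq₂
  have h6 := abs_inner_le_lineDist (u := e₁) hn hne
  have h7 := abs_inner_le_lineDist (u := e₂) hn hne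
  have h8 : x - a = (x - q) + (q - p) + (p - a) := by abel
  rw [h8, inner_add_right, inner_add_right]
  refine (abs_add_three _ _ _).trans ?_
  linarith

/-- Tubes of a hairbrush that meet away from the stem are almost coplanar with the stem. -/
theorem abs_inner_normal_le {δ r α : ℝ} (hδ : 0 < δ) (hr : 8 * δ ≤ r) {a e a₁ e₁ a₂ e₂ n : E3}
    (he : ‖e‖ = 1) (hn : ‖n‖ = 1) (hne : inner ℝ n e = 0)
    (hne₁ : inner ℝ n e₁ = 0) {p q q' : E3}
    (hp₁ : p ∈ segTube δ a₁ e₁) (hp₂ : p ∈ segTube δ a₂ e₂)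
    (hq : q ∈ segTube δ a e) (hq₂ : q ∈ segTube δ a₂ e₂)
    (hq' : q' ∈ segTube δ a e) (hq₁' : q' ∈ segTube δ a₁ e₁)
    (hfar : r < ‖perpPart e (p - a)‖) (h₂ : lineDist e₂ e ≤ α) :
    |inner ℝ n e₂| ≤ 12 * δ * α / r := by
  have hr0 : 0 < r := by linarith
  have hα : 0 ≤ α := (lineDist_nonneg _ _).trans h₂
  obtain ⟨t, ht, hpq⟩ := exists_sub_smul_le hp₂ hq₂
  have h3 := abs_inner_sub_le hn hp₁ hq₁'
  rw [hne₁, abs_zero, zero_add] at h3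
  have h4 := abs_inner_sub_le hn hq' hq
  rw [hne, abs_zero, zero_add] at h4
  have h5 : |t| * |inner ℝ n e₂| ≤ 6 * δ := by
    have h6 : t * inner ℝ n e₂
        = inner ℝ n (p - q') + inner ℝ n (q' - q) - inner ℝ n (p - q - t • e₂) := by
      simp only [inner_sub_right, inner_smul_right]; ring
    rw [← abs_mul, h6]
    have h7 := abs_real_inner_le_norm n (p - q - t • e₂)
    rw [hn, one_mul] at h7
    refine (abs_sub _ _).trans ?_
    have := abs_add_le (inner ℝ n (p - q')) (inner ℝ n (q' - q))
    linarith
  have h8 : r / 2 ≤ |t| * α := by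
    have h9 : perpPart e (p - a)
        = t • perpPart e e₂ + perpPart e (p - q - t • e₂) + perpPart e (q - a) := by
      rw [← perpPart_smul, ← perpPart_add, ← perpPart_add]; congr 1; abel
    rw [h9] at hfar
    have h10 := norm_add₃_le (a := t • perpPart e e₂) (b := perpPart e (p - q - t • e₂))
      (c := perpPart e (q - a))
    have h11 := (norm_perpPart_le he (p - q - t • e₂)).trans hpq
    have h12 : ‖perpPart e (q - a)‖ ≤ δ := segTube_subset_near he hq
    have h13 : ‖t • perpPart e e₂‖ ≤ |t| * α := by
      rw [norm_smul, Real.norm_eq_abs]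
      exact mul_le_mul_of_nonneg_left ((norm_perpPart_le_lineDist he).trans h₂) (abs_nonneg _)
    linarith
  rw [le_div_iff₀ hr0]
  have h14 := mul_le_mul_of_nonneg_right h8 (abs_nonneg (inner ℝ n e₂ : ℝ))
  have h15 := mul_le_mul_of_nonneg_right h5 hα
  nlinarith

/-- A tube in the unit ball which meets another one is contained in a box around the latter. -/
theorem segTube_subset_frameBox {δ φ ψ : ℝ} (b : OrthonormalBasis (Fin 3) ℝ E3)
    {a e a₂ e₂ p : E3} (hδ : 0 < δ) (hb : b 0 = e)
    (ha : segTube δ a e ⊆ Metric.closedBall 0 1) (ha₂ : segTube δ a₂ e₂ ⊆ Metric.closedBall 0 1)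
    (hp : p ∈ segTube δ a e) (hp₂ : p ∈ segTube δ a₂ e₂)
    (hφ : lineDist e₂ e ≤ φ) (hψ : |inner ℝ (b 2) e₂| ≤ ψ) :
    segTube δ a₂ e₂ ⊆ frameBox b a ![2, φ + 3 * δ, ψ + 3 * δ] := by
  intro x hx i
  have key : ∀ j, j ≠ 0 → |inner ℝ (b j) (x - a)| ≤ |inner ℝ (b j) e₂| + 3 * δ := by
    intro j hj
    have h1 := abs_inner_sub_base_le (b.norm_eq_one j) hp
    rw [← hb, inner_frame_eq_zero b hj, abs_zero, zero_add] at h1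
    have h2 := abs_inner_sub_le (b.norm_eq_one j) hx hp₂
    have h3 : x - a = (x - p) + (p - a) := by abel
    rw [h3, inner_add_right]
    exact (abs_add_le _ _).trans (by linarith)
  fin_cases i
  · simp only [Fin.zero_eta, Matrix.cons_val_zero]
    refine (abs_real_inner_le_norm _ _).trans ?_
    rw [b.norm_eq_one, one_mul]
    have h1 := ha₂ hx
    have h2 := ha (base_mem_segTube hδ.le a e)
    rw [mem_closedBall, dist_zero_right] at h1 h2
    exact (norm_sub_le _ _).trans (by linarith)
  · have h1 := key 1 (by decide)
    have h2 : |inner ℝ (b 1) e₂| ≤ lineDist e₂ e :=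
      abs_inner_le_lineDist (b.norm_eq_one 1)
        (by rw [← hb]; exact inner_frame_eq_zero b (by decide))
    simp only [Fin.mk_one, Matrix.cons_val_one, Matrix.cons_val_zero]
    linarith
  · have h1 := key 2 (by decide)
    simp only [Fin.reduceFinMk, Matrix.cons_val]
    linarith

/-- A shaded family of `δ`-tubes in the unit ball, indexed by a finite type, that is `τ`-dense
and satisfies the Katz–Tao convex and Frostman slab conditions with constant `τ⁻¹`. -/
structure IsWolffFamily {ι : Type*} [Fintype ι] (δ τ : ℝ) (a e : ι → E3) (Y : ι → Set E3) :
    Prop where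
  norm_eq (i : ι) : ‖e i‖ = 1
  subset_ball (i : ι) : segTube δ (a i) (e i) ⊆ closedBall 0 1
  subset_tube (i : ι) : Y i ⊆ segTube δ (a i) (e i)
  measurableSet (i : ι) : MeasurableSet (Y i)
  dense : τ * Fintype.card ι * δ ^ 2 ≤ ∑ i, vol (Y i)
  convex_wolff (W : Set E3) (L : Finset ι) : Convex ℝ W → Bornology.IsBounded W →
    (∀ i ∈ L, segTube δ (a i) (e i) ⊆ W) → (L.card : ℝ) ≤ τ⁻¹ * vol W / δ ^ 2
  slab_wolff (W : Set E3) (L : Finset ι) : IsSlab W →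
    (∀ i ∈ L, segTube δ (a i) (e i) ⊆ W) → (L.card : ℝ) ≤ τ⁻¹ * vol W * Fintype.card ι

namespace IsWolffFamily

variable {ι : Type*} [Fintype ι] {δ τ : ℝ} {a e : ι → E3} {Y : ι → Set E3}

theorem card_stems_le (h : IsWolffFamily δ τ a e Y) (hδ : 0 < δ) (hτ : 0 < τ) {α : ℝ}
    (hα : 0 ≤ α) (i₀ : ι) {p : E3} (hp : p ∈ segTube δ (a i₀) (e i₀)) (L : Finset ι)
    (hL : ∀ j ∈ L, lineDist (e j) (e i₀) ≤ 2 * α ∧ ∃ i q, lineDist (e i) (e i₀) ≤ α ∧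
      p ∈ segTube δ (a i) (e i) ∧ q ∈ segTube δ (a i) (e i) ∧ q ∈ segTube δ (a j) (e j)) :
    (L.card : ℝ) ≤ 16 * (3 * α + 5 * δ) * Fintype.card ι / τ := by
  obtain ⟨b, hb, -⟩ := exists_frame (e i₀) (e i₀) (h.norm_eq i₀)
  have hne : inner ℝ (b 2) (e i₀) = 0 := by
    rw [← hb]; exact inner_frame_eq_zero b (by decide)
  have hn : ‖b 2‖ = 1 := b.orthonormal.1 2
  obtain ⟨W, hW, hsub, hvol⟩ := exists_slab (r := 3 * α + 5 * δ) (by positivity) (a i₀) hn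
  have hcard := h.slab_wolff W L hW fun j hj x hx => by
    obtain ⟨hj₀, i, q, hi₀, hpi, hqi, hqj⟩ := hL j hj
    exact hsub x (h.subset_ball j hx) (abs_inner_chain_le hn hne hp hpi hqi hqj hx hi₀ hj₀)
  calc (L.card : ℝ) ≤ τ⁻¹ * vol W * Fintype.card ι := hcard
    _ ≤ τ⁻¹ * (16 * (3 * α + 5 * δ)) * Fintype.card ι := by gcongr
    _ = _ := by field_simp

theorem card_le_of_box (h : IsWolffFamily δ τ a e Y) (hδ : 0 < δ) (hτ : 0 < τ) {φ ψ : ℝ}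
    (hφ : 0 ≤ φ) (hψ : 0 ≤ ψ) (b : OrthonormalBasis (Fin 3) ℝ E3) (i : ι) (hb : b 0 = e i)
    (L : Finset ι) (hL : ∀ l ∈ L, lineDist (e l) (e i) ≤ φ ∧ |inner ℝ (b 2) (e l)| ≤ ψ ∧
      ∃ p ∈ segTube δ (a i) (e i), p ∈ segTube δ (a l) (e l)) :
    (L.card : ℝ) ≤ 16 * ((φ + 3 * δ) * (ψ + 3 * δ)) / (τ * δ ^ 2) := by
  have hcard := h.convex_wolff (frameBox b (a i) ![2, φ + 3 * δ, ψ + 3 * δ]) L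
    (convex_frameBox _ _ _) (isBounded_frameBox _ _ _) fun l hl => by
    obtain ⟨h₁, h₂, p, hpi, hpl⟩ := hL l hl
    exact segTube_subset_frameBox b hδ hb (h.subset_ball i) (h.subset_ball l) hpi hpl h₁ h₂
  refine hcard.trans (le_of_eq ?_)
  rw [vol_frameBox]
  · simp only [Matrix.cons_val_zero, Matrix.cons_val_one, Matrix.cons_val]
    field_simp
    ring
  · intro c
    fin_cases c <;> simp <;> positivity

theorem card_near_le (h : IsWolffFamily δ τ a e Y) (hδ : 0 < δ) (hτ : 0 < τ) {α : ℝ}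
    (hα : δ ≤ α) (i : ι) (L : Finset ι) (hL : ∀ l ∈ L, lineDist (e l) (e i) ≤ α ∧
      ∃ p ∈ segTube δ (a i) (e i), p ∈ segTube δ (a l) (e l)) :
    (L.card : ℝ) ≤ 256 * α ^ 2 / (τ * δ ^ 2) := by
  obtain ⟨b, hb, -⟩ := exists_frame (e i) (e i) (h.norm_eq i)
  have hα0 : 0 ≤ α := hδ.le.trans hα
  have := h.card_le_of_box hδ hτ hα0 hα0 b i hb L fun l hl => by
    refine ⟨(hL l hl).1, (abs_inner_le_lineDist (b.orthonormal.1 2) ?_).trans (hL l hl).1,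
      (hL l hl).2⟩
    rw [← hb]; exact inner_frame_eq_zero b (by decide)
  refine this.trans ?_
  have : 16 * ((α + 3 * δ) * (α + 3 * δ)) ≤ 256 * α ^ 2 := by nlinarith
  gcongr

theorem card_brush_le (h : IsWolffFamily δ τ a e Y) (hδ : 0 < δ) (hτ : 0 < τ) {α r φ : ℝ}
    (hr : 8 * δ ≤ r) (hα : r ≤ α) (hφ : δ ≤ φ) (j i : ι)
    (hji : ∃ q ∈ segTube δ (a j) (e j), q ∈ segTube δ (a i) (e i))
    (L : Finset ι) (hL : ∀ l ∈ L, lineDist (e l) (e i) ≤ φ ∧ lineDist (e l) (e j) ≤ α ∧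
      (∃ q ∈ segTube δ (a j) (e j), q ∈ segTube δ (a l) (e l)) ∧
      ∃ p ∈ segTube δ (a i) (e i), p ∈ segTube δ (a l) (e l) ∧ r < ‖perpPart (e j) (p - a j)‖) :
    (L.card : ℝ) ≤ 960 * α / (r * τ * δ) * φ := by
  obtain ⟨b, hb, hbj⟩ := exists_frame (e i) (e j) (h.norm_eq i)
  have hbi : inner ℝ (b 2) (e i) = 0 := by
    rw [← hb]; exact inner_frame_eq_zero b (by decide)
  have hr0 : 0 < r := by linarith
  have hα0 : 0 < α := by linarith
  have hφ0 : 0 < φ := by linarith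
  obtain ⟨q', hq'j, hq'i⟩ := hji
  have := h.card_le_of_box hδ hτ hφ0.le (ψ := 12 * δ * α / r) (by positivity) b i hb L
    fun l hl => by
    obtain ⟨h₁, h₂, ⟨q, hqj, hql⟩, p, hpi, hpl, hfar⟩ := hL l hl
    exact ⟨h₁, abs_inner_normal_le hδ hr (h.norm_eq j) (b.orthonormal.1 2) hbj hbi hpi hpl hqj
      hql hq'j hq'i hfar h₂, p, hpi, hpl⟩
  refine this.trans ?_
  have h₁ : φ + 3 * δ ≤ 4 * φ := by linarith
  have h₂ : 12 * δ * α / r + 3 * δ ≤ 15 * δ * α / r := by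
    have : δ ≤ δ * α / r := by rw [le_div_iff₀ hr0]; gcongr
    calc 12 * δ * α / r + 3 * δ ≤ 12 * δ * α / r + 3 * (δ * α / r) := by gcongr
      _ = _ := by ring
  calc 16 * ((φ + 3 * δ) * (12 * δ * α / r + 3 * δ)) / (τ * δ ^ 2)
      ≤ 16 * ((4 * φ) * (15 * δ * α / r)) / (τ * δ ^ 2) := by gcongr
    _ = _ := by field_simp; ring

end IsWolffFamily

theorem sum_le_of_dyadic_count {ι : Type*} (L : Finset ι) (v d : ι → ℝ) {τ Q : ℝ} (n : ℕ)
    (hτ : 0 < τ) (hτ1 : τ ≤ 1) (hd : ∀ l ∈ L, d l ≤ 2)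
    (hQ : ∀ φ, τ ^ n ≤ φ → ((L.filter fun l => d l ≤ φ).card : ℝ) ≤ Q * φ)
    (hv : ∀ l ∈ L, v l ≤ 12 * (τ ^ n) ^ 2)
    (hv' : ∀ l ∈ L, 0 < d l → v l ≤ 256 * (τ ^ n) ^ 3 / d l) :
    ∑ l ∈ L, v l ≤ 256 * (n + 1) * Q * (τ ^ n) ^ 3 / τ := by
  set δ := τ ^ n with hδ
  have hδ0 : 0 < δ := by positivity
  have key : ∀ l ∈ L, v l ≤ ∑ s ∈ Finset.range (n + 1),
      if d l ≤ 2 * τ ^ s then 128 * δ ^ 3 / τ ^ (s + 1) else 0 := by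
    intro l hl
    have hnn : ∀ s ∈ Finset.range (n + 1),
        0 ≤ if d l ≤ 2 * τ ^ s then 128 * δ ^ 3 / τ ^ (s + 1) else 0 := by
      intro s _; split_ifs <;> positivity
    let Z : Finset ℕ := (Finset.range (n + 1)).filter fun s => d l ≤ 2 * τ ^ s
    have hZ : Z.Nonempty := ⟨0, by simpa [Z] using hd l hl⟩
    obtain ⟨s, hs, hmax⟩ := Z.exists_max_image id hZ
    obtain ⟨hsr, hsd⟩ := Finset.mem_filter.1 hs
    refine le_trans ?_ (Finset.single_le_sum hnn hsr)
    rw [if_pos hsd]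
    rcases (Nat.lt_succ_iff.1 (Finset.mem_range.1 hsr)).lt_or_eq with hlt | rfl
    · have hgt : 2 * τ ^ (s + 1) < d l := by
        by_contra! hle
        have := hmax (s + 1) (Finset.mem_filter.2 ⟨Finset.mem_range.2 (by omega), hle⟩)
        simp at this
      have hpos : 0 < 2 * τ ^ (s + 1) := by positivity
      calc v l ≤ 256 * δ ^ 3 / d l := hv' l hl (hpos.trans hgt)
        _ ≤ 256 * δ ^ 3 / (2 * τ ^ (s + 1)) := by gcongr
        _ = _ := by field_simp; norm_num
    · refine (hv l hl).trans ?_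
      rw [le_div_iff₀ (by positivity), pow_succ τ s, ← hδ]
      have : 0 < δ ^ 3 := by positivity
      nlinarith
  calc ∑ l ∈ L, v l ≤ ∑ l ∈ L, ∑ s ∈ Finset.range (n + 1),
        (if d l ≤ 2 * τ ^ s then 128 * δ ^ 3 / τ ^ (s + 1) else 0) := Finset.sum_le_sum key
    _ = ∑ s ∈ Finset.range (n + 1),
        ((L.filter fun l => d l ≤ 2 * τ ^ s).card : ℝ) * (128 * δ ^ 3 / τ ^ (s + 1)) := by
        rw [Finset.sum_comm]
        refine Finset.sum_congr rfl fun s _ => ?_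
        rw [← Finset.sum_filter, Finset.sum_const, nsmul_eq_mul]
    _ ≤ ∑ s ∈ Finset.range (n + 1), (Q * (2 * τ ^ s)) * (128 * δ ^ 3 / τ ^ (s + 1)) := by
        refine Finset.sum_le_sum fun s hs => ?_
        refine mul_le_mul_of_nonneg_right (hQ _ ?_) (by positivity)
        have : τ ^ n ≤ τ ^ s :=
          pow_le_pow_of_le_one hτ.le hτ1 (Nat.lt_succ_iff.1 (Finset.mem_range.1 hs))
        have : 0 < τ ^ s := by positivity
        linarith
    _ = ∑ s ∈ Finset.range (n + 1), 256 * Q * δ ^ 3 / τ := by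
        refine Finset.sum_congr rfl fun s _ => ?_
        rw [pow_succ τ s]; field_simp; ring
    _ = _ := by simp; ring

/-- Refinement of a discretised shading to one at a single angular scale `τ ^ k`, broad at that
scale unless `k` is the last one. -/
theorem exists_broad_refinement {P ι : Type*} [Fintype P] [Fintype ι] (w : P → ℝ)
    (hw : ∀ p, 0 ≤ w p) (Y : ι → Finset P) (d : ι → ι → ℝ)
    (hd2 : ∀ i j, d i j ≤ 2) (hsymm : ∀ i j, d i j = d j i)
    (htri : ∀ i j l, d i l ≤ d i j + d j l) (τ : ℝ) (m : ℕ) :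
    ∃ k ≤ m, ∃ Z : ι → Finset P, (∀ i, Z i ⊆ Y i) ∧
      ∑ i, ∑ p ∈ Y i, w p ≤ 4 ^ m * (m + 1) * ∑ i, ∑ p ∈ Z i, w p ∧
      (∀ p i j, p ∈ Z i → p ∈ Z j → d i j ≤ 4 * τ ^ k) ∧
      (k < m → ∀ p i, p ∈ Z i →
        2 * (Finset.univ.filter fun j => p ∈ Z j ∧ d j i ≤ 2 * τ ^ (k + 1)).card
          ≤ (Finset.univ.filter fun j => p ∈ Z j).card) := by
  choose k hk S hSsub hScard hSd hSb using fun p : P =>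
    exists_broad_subset d hd2 hsymm htri (τ := τ) m (Finset.univ.filter fun i => p ∈ Y i)
  let Z : ℕ → ι → Finset P := fun s i => Finset.univ.filter fun p => k p = s ∧ i ∈ S p
  have hmem : ∀ s p i, p ∈ Z s i ↔ k p = s ∧ i ∈ S p := by simp [Z]
  have hfilter : ∀ p s, k p = s → (Finset.univ.filter fun j => p ∈ Z s j) = S p := by
    intro p s h; ext j; simp [hmem, h]
  have hswap : ∀ U : ι → Finset P, ∑ i, ∑ p ∈ U i, w p
      = ∑ p, ((Finset.univ.filter fun i => p ∈ U i).card : ℝ) * w p := by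
    intro U
    have : ∀ i, ∑ p ∈ U i, w p = ∑ p, if p ∈ U i then w p else 0 := by
      intro i; rw [← Finset.sum_filter]; congr 1; ext; simp
    simp_rw [this]
    rw [Finset.sum_comm]
    refine Finset.sum_congr rfl fun p _ => ?_
    rw [← Finset.sum_filter, Finset.sum_const, nsmul_eq_mul]
  have htotal : ∑ i, ∑ p ∈ Y i, w p
      ≤ ∑ s ∈ Finset.range (m + 1), 4 ^ m * ∑ i, ∑ p ∈ Z s i, w p := by
    rw [hswap, ← Finset.mul_sum]
    simp_rw [hswap]
    rw [Finset.sum_comm, Finset.mul_sum]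
    refine Finset.sum_le_sum fun p _ => ?_
    have h1 : ((S p).card : ℝ) * w p ≤ ∑ s ∈ Finset.range (m + 1),
        ((Finset.univ.filter fun i => p ∈ Z s i).card : ℝ) * w p := by
      refine le_trans (le_of_eq ?_) (Finset.single_le_sum (a := k p)
        (fun s _ => mul_nonneg (Nat.cast_nonneg _) (hw p))
        (Finset.mem_range.2 (Nat.lt_succ_of_le (hk p))))
      rw [hfilter p _ rfl]
    have h2 : ((Finset.univ.filter fun i => p ∈ Y i).card : ℝ) ≤ 4 ^ m * (S p).card := by
      exact_mod_cast hScard p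
    calc _ ≤ 4 ^ m * ((S p).card : ℝ) * w p := mul_le_mul_of_nonneg_right h2 (hw p)
      _ = 4 ^ m * (((S p).card : ℝ) * w p) := by ring
      _ ≤ _ := by gcongr
  obtain ⟨s, hs, hsle⟩ : ∃ s ∈ Finset.range (m + 1), (∑ i, ∑ p ∈ Y i, w p) / (m + 1)
      ≤ 4 ^ m * ∑ i, ∑ p ∈ Z s i, w p := by
    refine Finset.exists_le_of_sum_le ⟨0, by simp⟩ ?_
    refine le_trans (le_of_eq ?_) htotal
    simp only [Finset.sum_const, Finset.card_range, nsmul_eq_mul]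
    push_cast
    field_simp
  refine ⟨s, Nat.lt_succ_iff.1 (Finset.mem_range.1 hs), Z s, ?_, ?_, ?_, ?_⟩
  · intro i p hp
    have := hSsub p ((hmem s p i).1 hp).2
    simpa using this
  · rw [div_le_iff₀ (by positivity)] at hsle
    linarith
  · intro p i j hi hj
    obtain ⟨h1, h2⟩ := (hmem s p i).1 hi
    rw [← h1]
    exact hSd p i h2 j ((hmem s p j).1 hj).2
  · intro hsm p i hi
    obtain ⟨h1, h2⟩ := (hmem s p i).1 hi
    have := hSb p (h1 ▸ hsm) i h2
    rw [hfilter p s h1]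
    rw [h1] at this
    convert this using 3
    ext j
    simp [hmem, h1]

namespace IsWolffFamily

variable {ι P : Type*} [Fintype ι] {τ : ℝ} {a e : ι → E3} {Y : ι → Set E3}

theorem card_stems_le_of_discrete {δ : ℝ} (h : IsWolffFamily δ τ a e Y) (hδ : 0 < δ)
    (hτ : 0 < τ) {θ : ℝ} (hθ : δ ≤ θ) (x : P → E3) (Z : ι → Finset P)
    (hZ : ∀ i, ∀ p ∈ Z i, x p ∈ segTube δ (a i) (e i))
    (hd : ∀ p i j, p ∈ Z i → p ∈ Z j → lineDist (e i) (e j) ≤ 4 * θ) (p : P) (L : Finset ι)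
    (hL : ∀ j ∈ L, ∃ i, (Z j ∩ Z i).Nonempty ∧ p ∈ Z i) :
    (L.card : ℝ) ≤ 272 * θ * Fintype.card ι / τ := by
  have hθ0 : 0 < θ := hδ.trans_le hθ
  rcases L.eq_empty_or_nonempty with rfl | ⟨j₀, hj₀⟩
  · simp only [Finset.card_empty, Nat.cast_zero]
    positivity
  obtain ⟨i₀, -, hi₀⟩ := hL j₀ hj₀
  refine (h.card_stems_le hδ hτ (α := 4 * θ) (by positivity) i₀ (hZ i₀ p hi₀) L ?_).trans ?_
  · intro j hj
    obtain ⟨i, ⟨q, hq⟩, hpi⟩ := hL j hj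
    obtain ⟨hqj, hqi⟩ := Finset.mem_inter.1 hq
    have h₁ := hd p i i₀ hpi hi₀
    refine ⟨?_, i, x q, h₁, hZ i p hpi, hZ i q hqi, hZ j q hqj⟩
    linarith [lineDist_triangle (e j) (e i) (e i₀), hd q j i hqj hqi]
  · have : 16 * (3 * (4 * θ) + 5 * δ) ≤ 272 * θ := by linarith
    gcongr

variable [Fintype P]

/-- The hairbrush argument at an angular scale at which the shading is broad. -/
theorem hairbrush_broad {m k : ℕ} (hk : k < m) (h : IsWolffFamily (τ ^ (m + 2)) τ a e Y)
    (hτ : 0 < τ) (hτ1 : τ ≤ 1) (hδ2 : τ ^ (m + 2) ≤ 1 / 2) {c : ℝ} (hc : 0 < c) (hc1 : c ≤ 1)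
    (hcτ : 2048 * τ ≤ c) (x : P → E3) (w : P → ℝ) (hw : ∀ p, 0 ≤ w p) (Z : ι → Finset P)
    (hZ : ∀ i, ∀ p ∈ Z i, x p ∈ segTube (τ ^ (m + 2)) (a i) (e i))
    (hd : ∀ p i j, p ∈ Z i → p ∈ Z j → lineDist (e i) (e j) ≤ 4 * τ ^ k)
    (hb : ∀ p i, p ∈ Z i →
      2 * (Finset.univ.filter fun j => p ∈ Z j ∧ lineDist (e j) (e i) ≤ 2 * τ ^ (k + 1)).card
        ≤ (Finset.univ.filter fun j => p ∈ Z j).card)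
    (hinter : ∀ i j, ∑ p ∈ Z i ∩ Z j, w p ≤ vol (segTube (τ ^ (m + 2)) (a i) (e i) ∩
      {y | ‖perpPart (e j) (y - a j)‖ ≤ τ ^ (m + 2)}))
    (hnear : ∀ i j, ∑ p ∈ Z i with ‖perpPart (e j) (x p - a j)‖ ≤ c * τ ^ 2 * τ ^ k / 256, w p
      ≤ vol (segTube (τ ^ (m + 2)) (a i) (e i) ∩
        {y | ‖perpPart (e j) (y - a j)‖ ≤ c * τ ^ 2 * τ ^ k / 256}))
    (hmass : 2 * Fintype.card ι * (c * τ * (τ ^ (m + 2)) ^ 2) ≤ ∑ i, ∑ p ∈ Z i, w p) :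
    (∑ i, ∑ p ∈ Z i, w p) ^ 2 * (c * τ * (τ ^ (m + 2)) ^ 2) ^ 2
      ≤ 64 * (∑ p ∈ Finset.univ.biUnion Z, w p) ^ 2 * ((272 * τ ^ k * Fintype.card ι / τ) *
        (256 * ((m + 2 : ℕ) + 1) * (960 * 1024 / (c * τ ^ 3 * τ ^ (m + 2))) *
          (τ ^ (m + 2)) ^ 3 / τ) *
        (128 * (τ ^ (m + 2)) ^ 3 / (τ ^ k * τ))) := by
  set δ := τ ^ (m + 2) with hδdef
  set θ := τ ^ k with hθdef
  set r := c * τ ^ 2 * θ / 256 with hrdef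
  have hδ : 0 < δ := by positivity
  have hθ : 0 < θ := by positivity
  have hδk : δ ≤ θ * τ ^ 3 := by
    rw [hδdef, hθdef, ← pow_add]
    exact pow_le_pow_of_le_one hτ.le hτ1 (by omega)
  have hδθ : δ ≤ θ := by
    have : τ ^ 3 ≤ 1 := pow_le_one₀ hτ.le hτ1
    nlinarith
  have hr : 8 * δ ≤ r := by
    have : 0 < θ * τ ^ 2 := by positivity
    have : 2048 * τ * (θ * τ ^ 2) ≤ c * (θ * τ ^ 2) := by gcongr
    rw [hrdef]
    nlinarith
  have hr0 : 0 < r := by linarith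
  have hrα : r ≤ 4 * θ := by
    have : c * τ ^ 2 ≤ 1 := mul_le_one₀ hc1 (by positivity) (pow_le_one₀ hτ.le hτ1)
    rw [hrdef]
    nlinarith
  have hsep : ∀ i j, 2 * τ ^ (k + 1) < lineDist (e i) (e j) → 0 < lineDist (e i) (e j) :=
    fun i j hij => lt_trans (by positivity) hij
  have hvol : ∀ i S, vol (segTube δ (a i) (e i) ∩ S) ≤ 12 * δ ^ 2 := fun i S =>
    (vol_mono inter_subset_left (isBounded_segTube _ _ _)).trans
      (vol_segTube_le hδ hδ2 _ (h.norm_eq i))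
  refine hairbrush_inequality w hw Z
    (fun j => Finset.univ.filter fun p => ‖perpPart (e j) (x p - a j)‖ ≤ r)
    (fun j i => 2 * τ ^ (k + 1) < lineDist (e j) (e i))
    (by positivity) (by positivity) (by positivity) (by positivity) ?_ ?_ ?_ ?_ ?_ hmass
  · intro p i hp
    have h₁ := hb p i hp
    have h₂ := Finset.card_filter_add_card_filter_not
      (s := Finset.univ.filter fun j => p ∈ Z j) fun j => lineDist (e j) (e i) ≤ 2 * τ ^ (k + 1)
    simp only [Finset.filter_filter, not_le] at h₂
    have h₃ : (Finset.univ.filter fun j => p ∈ Z j).card ≤ 2 * (Finset.univ.filter fun j =>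
      p ∈ Z j ∧ 2 * τ ^ (k + 1) < lineDist (e j) (e i)).card := by omega
    exact_mod_cast h₃
  · intro j i hji
    refine (hinter j i).trans ((vol_segTube_inter_near_le hδ le_rfl (h.norm_eq j) (h.norm_eq i)
      (hsep j i hji)).trans ?_)
    calc 256 * δ ^ 2 * δ / lineDist (e j) (e i)
        ≤ 256 * δ ^ 2 * δ / (2 * τ ^ (k + 1)) := by gcongr
      _ = _ := by rw [pow_succ τ k, ← hθdef]; field_simp; norm_num
  · intro j i hji
    have hij : 2 * τ ^ (k + 1) < lineDist (e i) (e j) := by rwa [lineDist_comm]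
    have hset : Z i ∩ (Finset.univ.filter fun p => ‖perpPart (e j) (x p - a j)‖ ≤ r)
        = (Z i).filter fun p => ‖perpPart (e j) (x p - a j)‖ ≤ r := by
      ext; simp
    rw [hset]
    refine (hnear i j).trans ((vol_segTube_inter_near_le hδ (by linarith) (h.norm_eq i)
      (h.norm_eq j) (hsep i j hij)).trans ?_)
    calc 256 * δ ^ 2 * r / lineDist (e i) (e j)
        ≤ 256 * δ ^ 2 * r / (2 * τ ^ (k + 1)) := by gcongr
      _ = _ := by rw [pow_succ τ k, ← hθdef, hrdef]; field_simp
  · intro p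
    refine h.card_stems_le_of_discrete hδ hτ hδθ x Z hZ hd p _ fun j hj => ?_
    obtain ⟨i, -, hne, hp⟩ := (Finset.mem_filter.1 hj).2
    exact ⟨i, hne, (Finset.mem_sdiff.1 hp).1⟩
  · intro j i hji hne
    set L := (Finset.univ.filter fun l =>
      2 * τ ^ (k + 1) < lineDist (e j) (e l) ∧ (Z j ∩ Z l).Nonempty).filter fun l =>
        ((Z i ∩ Z l) \ Finset.univ.filter fun p => ‖perpPart (e j) (x p - a j)‖ ≤ r).Nonempty
      with hL
    rw [← Finset.sum_filter_of_ne (p := fun l => ((Z i ∩ Z l) \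
      Finset.univ.filter fun p => ‖perpPart (e j) (x p - a j)‖ ≤ r).Nonempty) (by
        intro l _ hl
        by_contra hcon
        rw [Finset.not_nonempty_iff_eq_empty] at hcon
        exact hl (by rw [hcon, Finset.sum_empty])), ← hL]
    have hle : ∀ l, ∑ p ∈ (Z i ∩ Z l) \ Finset.univ.filter
        (fun p => ‖perpPart (e j) (x p - a j)‖ ≤ r), w p ≤ ∑ p ∈ Z l ∩ Z i, w p := by
      intro l
      rw [Finset.inter_comm (Z l)]
      exact Finset.sum_le_sum_of_subset_of_nonneg Finset.sdiff_subset fun p _ _ => hw p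
    refine sum_le_of_dyadic_count L _ (fun l => lineDist (e l) (e i)) (m + 2) hτ hτ1
      (fun l _ => lineDist_le_two (h.norm_eq l) (h.norm_eq i)) ?_ ?_ ?_
    · intro φ hφ
      obtain ⟨q, hq⟩ := hne
      obtain ⟨hqj, hqi⟩ := Finset.mem_inter.1 hq
      refine (h.card_brush_le hδ hτ hr hrα hφ j i ⟨x q, hZ j q hqj, hZ i q hqi⟩ _ ?_).trans
        (le_of_eq ?_)
      · intro l hl
        obtain ⟨hlL, hlφ⟩ := Finset.mem_filter.1 hl
        obtain ⟨hlL, ⟨p, hp⟩⟩ := Finset.mem_filter.1 hlL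
        obtain ⟨-, -, ⟨q', hq'⟩⟩ := Finset.mem_filter.1 hlL
        obtain ⟨hq'j, hq'l⟩ := Finset.mem_inter.1 hq'
        obtain ⟨hp, hpf⟩ := Finset.mem_sdiff.1 hp
        obtain ⟨hpi, hpl⟩ := Finset.mem_inter.1 hp
        refine ⟨hlφ, hd q' l j hq'l hq'j, ⟨x q', hZ j q' hq'j, hZ l q' hq'l⟩, x p, hZ i p hpi,
          hZ l p hpl, ?_⟩
        simpa using hpf
      · rw [hrdef]; field_simp; ring
    · exact fun l _ => (hle l).trans ((hinter l i).trans (hvol l _))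
    · intro l _ hl
      refine (hle l).trans ((hinter l i).trans ((vol_segTube_inter_near_le hδ le_rfl
        (h.norm_eq l) (h.norm_eq i) hl).trans (le_of_eq ?_)))
      ring

/-- The hairbrush argument at the finest angular scale. -/
theorem hairbrush_narrow {m : ℕ} (h : IsWolffFamily (τ ^ (m + 2)) τ a e Y)
    (hτ : 0 < τ) (hτ1 : τ ≤ 1) (hδ2 : τ ^ (m + 2) ≤ 1 / 2) {c : ℝ} (hc : 0 < c)
    (x : P → E3) (w : P → ℝ) (hw : ∀ p, 0 ≤ w p) (Z : ι → Finset P)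
    (hZ : ∀ i, ∀ p ∈ Z i, x p ∈ segTube (τ ^ (m + 2)) (a i) (e i))
    (hd : ∀ p i j, p ∈ Z i → p ∈ Z j → lineDist (e i) (e j) ≤ 4 * τ ^ m)
    (hinter : ∀ i j, ∑ p ∈ Z i ∩ Z j, w p ≤ vol (segTube (τ ^ (m + 2)) (a i) (e i) ∩
      {y | ‖perpPart (e j) (y - a j)‖ ≤ τ ^ (m + 2)}))
    (hmass : 2 * Fintype.card ι * (c * τ * (τ ^ (m + 2)) ^ 2) ≤ ∑ i, ∑ p ∈ Z i, w p) :
    (∑ i, ∑ p ∈ Z i, w p) ^ 2 * (c * τ * (τ ^ (m + 2)) ^ 2) ^ 2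
      ≤ 64 * (∑ p ∈ Finset.univ.biUnion Z, w p) ^ 2 * ((272 * τ ^ m * Fintype.card ι / τ) *
        (256 * (4 * τ ^ m) ^ 2 / (τ * (τ ^ (m + 2)) ^ 2) * (12 * (τ ^ (m + 2)) ^ 2)) *
        (12 * (τ ^ (m + 2)) ^ 2)) := by
  set δ := τ ^ (m + 2) with hδdef
  set θ := τ ^ m with hθdef
  have hδ : 0 < δ := by positivity
  have hθ : 0 < θ := by positivity
  have hδθ : δ ≤ θ := pow_le_pow_of_le_one hτ.le hτ1 (by omega)
  have hD : ∀ i j, ∑ p ∈ Z i ∩ Z j, w p ≤ 12 * δ ^ 2 := fun i j =>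
    (hinter i j).trans ((vol_mono inter_subset_left (isBounded_segTube _ _ _)).trans
      (vol_segTube_le hδ hδ2 _ (h.norm_eq i)))
  refine hairbrush_inequality w hw Z (fun _ => ∅) (fun _ _ => True)
    (by positivity) (by positivity) (by positivity) (by positivity) ?_ ?_ ?_ ?_ ?_ hmass
  · intro p i _
    simp only [and_true]
    linarith [Nat.cast_nonneg (α := ℝ) (Finset.univ.filter fun j => p ∈ Z j).card]
  · exact fun j i _ => hD j i
  · intro j i _
    rw [Finset.inter_empty, Finset.sum_empty]
    positivity
  · intro p
    have key := h.card_stems_le_of_discrete hδ hτ hδθ x Z hZ hd p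
      (Finset.univ.filter fun j => ∃ i, True ∧ (Z j ∩ Z i).Nonempty ∧ p ∈ Z i \ ∅) fun j hj => by
      obtain ⟨i, -, hne, hp⟩ := (Finset.mem_filter.1 hj).2
      exact ⟨i, hne, (Finset.mem_sdiff.1 hp).1⟩
    convert key
  · intro j i _ _
    simp only [true_and, Finset.sdiff_empty]
    set L := (Finset.univ.filter fun l => (Z j ∩ Z l).Nonempty).filter fun l =>
      (Z i ∩ Z l).Nonempty with hL
    rw [← Finset.sum_filter_of_ne (p := fun l => (Z i ∩ Z l).Nonempty) (by
        intro l _ hl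
        by_contra hcon
        rw [Finset.not_nonempty_iff_eq_empty] at hcon
        exact hl (by rw [hcon, Finset.sum_empty])), ← hL]
    have hcard : (L.card : ℝ) ≤ 256 * (4 * θ) ^ 2 / (τ * δ ^ 2) := by
      refine h.card_near_le hδ hτ (by linarith) i L fun l hl => ?_
      obtain ⟨-, p, hp⟩ := Finset.mem_filter.1 hl
      obtain ⟨hpi, hpl⟩ := Finset.mem_inter.1 hp
      exact ⟨hd p l i hpl hpi, x p, hZ i p hpi, hZ l p hpl⟩
    calc ∑ l ∈ L, ∑ p ∈ Z i ∩ Z l, w p ≤ L.card • (12 * δ ^ 2) :=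
          Finset.sum_le_card_nsmul _ _ _ fun l _ => hD i l
      _ ≤ _ := by rw [nsmul_eq_mul]; gcongr

end IsWolffFamily

namespace IsWolffFamily

variable {ι : Type*} [Fintype ι] {τ : ℝ} {a e : ι → E3} {Y : ι → Set E3}

/-- A finite weighted model of the shading that computes the relevant volumes. -/
theorem exists_discretization {δ : ℝ} (h : IsWolffFamily δ τ a e Y) (m : ℕ) (r : ℕ → ℝ) :
    ∃ (P : Type) (_ : Fintype P) (x : P → E3) (w : P → ℝ), (∀ p, 0 ≤ w p) ∧
      ∀ A : Set E3, A ⊆ closedBall 0 1 →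
        (∀ y z, (∀ i, y ∈ Y i ↔ z ∈ Y i) → (∀ i, ∀ k ≤ m, ‖perpPart (e i) (y - a i)‖ ≤ r k ↔
          ‖perpPart (e i) (z - a i)‖ ≤ r k) → y ∈ A → z ∈ A) →
        ∃ S : Finset P, (∀ p, p ∈ S ↔ x p ∈ A) ∧ ∑ p ∈ S, w p = vol A := by
  let F : ι ⊕ ι × Fin (m + 1) → Set E3 := Sum.elim Y
    fun q => {y | ‖perpPart (e q.1) (y - a q.1)‖ ≤ r q.2}
  have hfin : IsFiniteMeasure (volume.restrict (closedBall (0 : E3) 1)) :=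
    isFiniteMeasure_restrict.2 measure_closedBall_lt_top.ne
  obtain ⟨P, w, hw, hP⟩ := exists_weighted_points
    (volume.restrict (closedBall (0 : E3) 1)) F (by
      rintro (i | q)
      · exact h.measurableSet i
      · exact measurableSet_near _ _ _)
  refine ⟨P, inferInstance, fun p => p.1, fun p => w p, fun p => hw p, fun A hA hinv =>
    ⟨Finset.univ.filter fun p => p.1 ∈ A, by simp, ?_⟩⟩
  rw [Finset.sum_filter, Finset.sum_coe_sort P (fun p => if p ∈ A then w p else 0),
    ← Finset.sum_filter, hP A, measureReal_restrict_apply' measurableSet_closedBall,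
    inter_eq_left.2 hA]
  · rfl
  · exact fun y z hyz => hinv y z (fun i => hyz (.inl i))
      fun i k hk => hyz (.inr (i, ⟨k, Nat.lt_succ_of_le hk⟩))

theorem hairbrush_volume_sq {m : ℕ} (h : IsWolffFamily (τ ^ (m + 2)) τ a e Y)
    (hτ : 0 < τ) (hτ1 : τ ≤ 1) (hδ2 : τ ^ (m + 2) ≤ 1 / 2) {c : ℝ}
    (hc : c = 1 / (2 * (4 ^ m * (m + 1)))) (hcτ : 2048 * τ ≤ c) :
    c ^ 4 * (Fintype.card ι * (τ ^ (m + 2)) ^ 3 * τ ^ 12)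
      ≤ 16 * (272 * 256 * (m + 3) * (960 * 1024) * 128 / c + 272 * 4096 * 144)
        * vol (⋃ i, Y i) ^ 2 := by
  have hc0 : 0 < c := by rw [hc]; positivity
  have hc1 : c ≤ 1 := by
    rw [hc]
    have : (1 : ℝ) ≤ 4 ^ m := one_le_pow₀ (by norm_num)
    rw [div_le_one (by positivity)]
    nlinarith [Nat.cast_nonneg (α := ℝ) m]
  obtain ⟨P, _, x, w, hw, hP⟩ := h.exists_discretization m fun k => c * τ ^ 2 * τ ^ k / 256
  have hball : ∀ i, Y i ⊆ closedBall 0 1 := fun i => (h.subset_tube i).trans (h.subset_ball i)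
  choose V hVmem hVsum using fun i => hP (Y i) (hball i) fun y z hy _ => (hy i).1
  obtain ⟨k, hk, Z, hZV, hZmass, hZd, hZb⟩ := exists_broad_refinement w hw V
    (fun i j => lineDist (e i) (e j)) (fun i j => lineDist_le_two (h.norm_eq i) (h.norm_eq j))
    (fun i j => lineDist_comm _ _) (fun i j l => lineDist_triangle _ _ _) τ m
  have hmem : ∀ i, ∀ p ∈ Z i, x p ∈ Y i := fun i p hp => (hVmem i p).1 (hZV i hp)
  have hseg : ∀ i, ∀ p ∈ Z i, x p ∈ segTube (τ ^ (m + 2)) (a i) (e i) :=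
    fun i p hp => h.subset_tube i (hmem i p hp)
  set δ := τ ^ (m + 2) with hδdef
  have hδ : 0 < δ := by positivity
  set N : ℝ := (Fintype.card ι : ℝ) with hN
  have hmass : 2 * N * (c * τ * δ ^ 2) ≤ ∑ i, ∑ p ∈ Z i, w p := by
    simp only [hVsum] at hZmass
    have h₂ : τ * N * δ ^ 2 ≤ 4 ^ m * (m + 1) * ∑ i, ∑ p ∈ Z i, w p := h.dense.trans hZmass
    have : 2 * N * (c * τ * δ ^ 2) = τ * N * δ ^ 2 / (4 ^ m * (m + 1)) := by
      rw [hc]; field_simp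
    rw [this, div_le_iff₀ (by positivity)]
    linarith
  have hsum_le : ∀ (A : Set E3) (U : Finset P), A ⊆ closedBall 0 1 →
      (∀ y z, (∀ i, y ∈ Y i ↔ z ∈ Y i) → (∀ i, ∀ k ≤ m,
        ‖perpPart (e i) (y - a i)‖ ≤ c * τ ^ 2 * τ ^ k / 256 ↔
          ‖perpPart (e i) (z - a i)‖ ≤ c * τ ^ 2 * τ ^ k / 256) → y ∈ A → z ∈ A) →
      (∀ p ∈ U, x p ∈ A) → ∑ p ∈ U, w p ≤ vol A := by
    intro A U hA hinv hU
    obtain ⟨S, hS, hSsum⟩ := hP A hA hinv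
    rw [← hSsum]
    exact Finset.sum_le_sum_of_subset_of_nonneg (fun p hp => (hS p).2 (hU p hp)) fun p _ _ => hw p
  have hinter : ∀ i j, ∑ p ∈ Z i ∩ Z j, w p ≤ vol (segTube δ (a i) (e i) ∩
      {y | ‖perpPart (e j) (y - a j)‖ ≤ δ}) := by
    intro i j
    refine (hsum_le (Y i ∩ Y j) _ (inter_subset_left.trans (hball i))
      (fun y z hy _ h => ⟨(hy i).1 h.1, (hy j).1 h.2⟩) fun p hp => ?_).trans
      (vol_mono (inter_subset_inter (h.subset_tube i)
        ((h.subset_tube j).trans (segTube_subset_near (h.norm_eq j))))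
        ((isBounded_segTube _ _ _).subset inter_subset_left))
    obtain ⟨h₁, h₂⟩ := Finset.mem_inter.1 hp
    exact ⟨hmem i p h₁, hmem j p h₂⟩
  have hnear : ∀ i j, ∑ p ∈ Z i with
      ‖perpPart (e j) (x p - a j)‖ ≤ c * τ ^ 2 * τ ^ k / 256, w p
      ≤ vol (segTube δ (a i) (e i) ∩
        {y | ‖perpPart (e j) (y - a j)‖ ≤ c * τ ^ 2 * τ ^ k / 256}) := by
    intro i j
    refine (hsum_le (Y i ∩ {y | ‖perpPart (e j) (y - a j)‖ ≤ c * τ ^ 2 * τ ^ k / 256}) _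
      (inter_subset_left.trans (hball i))
      (fun y z hy hr h => ⟨(hy i).1 h.1, (hr j k hk).1 h.2⟩) fun p hp => ?_).trans
      (vol_mono (inter_subset_inter_left _ (h.subset_tube i))
        ((isBounded_segTube _ _ _).subset inter_subset_left))
    obtain ⟨h₁, h₂⟩ := Finset.mem_filter.1 hp
    exact ⟨hmem i p h₁, h₂⟩
  have hunion : ∑ p ∈ Finset.univ.biUnion Z, w p ≤ vol (⋃ i, Y i) := by
    refine hsum_le _ _ (iUnion_subset hball) (fun y z hy _ h => ?_) fun p hp => ?_
    · obtain ⟨i, hi⟩ := mem_iUnion.1 h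
      exact mem_iUnion.2 ⟨i, (hy i).1 hi⟩
    · obtain ⟨i, -, hi⟩ := Finset.mem_biUnion.1 hp
      exact mem_iUnion.2 ⟨i, hmem i p hi⟩
  have hunion0 : 0 ≤ ∑ p ∈ Finset.univ.biUnion Z, w p :=
    Finset.sum_nonneg fun p _ => hw p
  set K := 272 * 256 * ((m : ℝ) + 3) * (960 * 1024) * 128 / c + 272 * 4096 * 144 with hK
  have hN0 : 0 ≤ N := Nat.cast_nonneg _
  have main : (∑ i, ∑ p ∈ Z i, w p) ^ 2 * (c * τ * δ ^ 2) ^ 2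
      ≤ 64 * (∑ p ∈ Finset.univ.biUnion Z, w p) ^ 2 * (K * N * δ ^ 5 / τ ^ 8) := by
    rcases hk.lt_or_eq with hlt | rfl
    · refine (h.hairbrush_broad hlt hτ hτ1 hδ2 hc0 hc1 hcτ x w hw Z hseg hZd (hZb hlt) hinter
        hnear hmass).trans
        (mul_le_mul_of_nonneg_left ?_ (by positivity))
      rw [← hδdef, ← hN]
      calc _ = 272 * 256 * ((m : ℝ) + 3) * (960 * 1024) * 128 / c * N * δ ^ 5 / τ ^ 8 * τ ^ 2 := by
            push_cast
            field_simp
            ring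
        _ ≤ K * N * δ ^ 5 / τ ^ 8 * 1 := by
            gcongr
            · rw [hK]; linarith
            · exact pow_le_one₀ hτ.le hτ1
        _ = _ := mul_one _
    · refine (h.hairbrush_narrow hτ hτ1 hδ2 hc0 x w hw Z hseg hZd hinter hmass).trans
        (mul_le_mul_of_nonneg_left ?_ (by positivity))
      rw [← hδdef, ← hN]
      have hθ : τ ^ k = δ / τ ^ 2 := by rw [hδdef, pow_add]; field_simp
      rw [hθ]
      calc _ = 272 * 4096 * 144 * N * δ ^ 5 / τ ^ 8 := by
            field_simp
            ring
        _ ≤ K * N * δ ^ 5 / τ ^ 8 := by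
            gcongr
            rw [hK]
            have : 0 ≤ 272 * 256 * ((k : ℝ) + 3) * (960 * 1024) * 128 / c := by positivity
            linarith
  have hK0 : 0 < K := by positivity
  have h₁ : (2 * N * (c * τ * δ ^ 2)) ^ 2 * (c * τ * δ ^ 2) ^ 2
      ≤ 64 * vol (⋃ i, Y i) ^ 2 * (K * N * δ ^ 5 / τ ^ 8) := by
    refine le_trans ?_ (main.trans ?_) <;> gcongr
  rcases hN0.eq_or_lt with h0 | hpos
  · rw [← h0, zero_mul, zero_mul, mul_zero]
    positivity
  have h₂ : c ^ 4 * (N * δ ^ 3 * τ ^ 12) * (4 * N * δ ^ 5 / τ ^ 8)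
      ≤ 16 * K * vol (⋃ i, Y i) ^ 2 * (4 * N * δ ^ 5 / τ ^ 8) := by
    calc _ = (2 * N * (c * τ * δ ^ 2)) ^ 2 * (c * τ * δ ^ 2) ^ 2 := by field_simp; ring
      _ ≤ _ := h₁
      _ = _ := by ring
  exact le_of_mul_le_mul_right h₂ (by positivity)

end IsWolffFamily

theorem IsWolffFamily.exists_volume_sq_bound (m : ℕ) : ∃ C : ℝ, 0 < C ∧
    ∀ {ι : Type} [Fintype ι] {τ : ℝ} {a e : ι → E3} {Y : ι → Set E3}, 0 < τ → τ ≤ 1 →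
      τ ^ (m + 2) ≤ 1 / 2 → IsWolffFamily (τ ^ (m + 2)) τ a e Y →
      C * (Fintype.card ι * (τ ^ (m + 2)) ^ 3 * τ ^ 12) ≤ vol (⋃ i, Y i) ^ 2 := by
  set c : ℝ := 1 / (2 * (4 ^ m * (m + 1))) with hc
  have hc0 : 0 < c := by positivity
  set K : ℝ := 16 * (272 * 256 * (m + 3) * (960 * 1024) * 128 / c + 272 * 4096 * 144) with hK
  have hK0 : 0 < K := by positivity
  set B : ℝ := vol (closedBall (0 : E3) 1) + 1 with hB
  have hB0 : 0 < B := by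
    have : 0 ≤ vol (closedBall (0 : E3) 1) := ENNReal.toReal_nonneg
    linarith
  refine ⟨min (c ^ 4 / K) ((c / 2048) ^ (3 * (m + 2)) / B), by positivity, ?_⟩
  intro ι _ τ a e Y hτ hτ1 hδ2 h
  have hδ : 0 < τ ^ (m + 2) := by positivity
  rcases le_or_gt (2048 * τ) c with hcτ | hcτ
  · have key := h.hairbrush_volume_sq hτ hτ1 hδ2 hc hcτ
    rw [← hK] at key
    calc _ ≤ c ^ 4 / K * (Fintype.card ι * (τ ^ (m + 2)) ^ 3 * τ ^ 12) := by
          gcongr; exact min_le_left _ _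
      _ = c ^ 4 * (Fintype.card ι * (τ ^ (m + 2)) ^ 3 * τ ^ 12) / K := by ring
      _ ≤ _ := by rw [div_le_iff₀ hK0]; linarith
  · set δ := τ ^ (m + 2) with hδdef
    rcases isEmpty_or_nonempty ι with hι | hι
    · simp only [Fintype.card_eq_zero, Nat.cast_zero, zero_mul, mul_zero]
      positivity
    obtain ⟨i, -, hi⟩ : ∃ i ∈ Finset.univ, τ * δ ^ 2 ≤ vol (Y i) := by
      refine Finset.exists_le_of_sum_le Finset.univ_nonempty ?_
      rw [Finset.sum_const, nsmul_eq_mul, Finset.card_univ]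
      linarith [h.dense]
    have hE : τ * δ ^ 2 ≤ vol (⋃ i, Y i) := hi.trans (vol_mono (subset_iUnion _ i)
      (isBounded_closedBall.subset
        (iUnion_subset fun i => (h.subset_tube i).trans (h.subset_ball i))))
    have hN := h.convex_wolff (closedBall 0 1) Finset.univ (convex_closedBall _ _)
      isBounded_closedBall fun i _ => h.subset_ball i
    rw [Finset.card_univ] at hN
    have hN' : (Fintype.card ι : ℝ) ≤ B / (τ * δ ^ 2) := by
      refine hN.trans ?_
      rw [inv_mul_eq_div, div_div]
      gcongr
      linarith
    have hδ3 : (c / 2048) ^ (3 * (m + 2)) ≤ δ ^ 3 := by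
      rw [hδdef, ← pow_mul, mul_comm (m + 2) 3]
      exact pow_le_pow_left₀ (by positivity) (by linarith) _
    calc _ ≤ (c / 2048) ^ (3 * (m + 2)) / B * (B / (τ * δ ^ 2) * δ ^ 3 * τ ^ 12) := by
          gcongr; exact min_le_right _ _
      _ = (c / 2048) ^ (3 * (m + 2)) * (τ ^ 2 * δ) * τ ^ 9 := by field_simp
      _ ≤ δ ^ 3 * (τ ^ 2 * δ) * 1 := by gcongr; exact pow_le_one₀ hτ.le hτ1
      _ = (τ * δ ^ 2) ^ 2 := by ring
      _ ≤ _ := by gcongr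

theorem IsTube.exists_eq_segTube {δ : ℝ} (hδ : 0 ≤ δ) {T : Set E3} (h : IsTube δ T) :
    ∃ a e : E3, ‖e‖ = 1 ∧ T = segTube δ a e := by
  obtain ⟨a, e, he, rfl⟩ := h
  exact ⟨a, e, he, cthickening_segment_eq hδ a e⟩

theorem le_half_of_segTube_subset_ball {δ : ℝ} (hδ : 0 ≤ δ) {a e : E3} (he : ‖e‖ = 1)
    (h : segTube δ a e ⊆ closedBall 0 1) : δ ≤ 1 / 2 := by
  have h₁ : ‖a - δ • e‖ ≤ 1 := by
    simpa using h (show a - δ • e ∈ segTube δ a e from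
      ⟨0, le_rfl, zero_le_one, by simp [norm_smul, he, abs_of_nonneg hδ]⟩)
  have h₂ : ‖a + (1 + δ) • e‖ ≤ 1 := by
    simpa using h (show a + (1 + δ) • e ∈ segTube δ a e from ⟨1, zero_le_one, le_rfl, by
      rw [show a + (1 + δ) • e - (a + (1 : ℝ) • e) = δ • e by module]
      simp [norm_smul, he, abs_of_nonneg hδ]⟩)
  have h₃ : ‖(1 + 2 * δ) • e‖ ≤ 2 := by
    rw [show (1 + 2 * δ) • e = (a + (1 + δ) • e) - (a - δ • e) by module]
    exact (norm_sub_le _ _).trans (by linarith)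
  rw [norm_smul, he, mul_one, Real.norm_eq_abs, abs_of_nonneg (by linarith)] at h₃
  linarith

theorem tubeVol_eq {δ : ℝ} (hδ : 0 ≤ δ) :
    tubeVol δ = vol (segTube δ 0 (EuclideanSpace.single (0 : Fin 3) (1 : ℝ))) := by
  rw [tubeVol, ← cthickening_segment_eq hδ, zero_add]

theorem le_tubeVol {δ : ℝ} (hδ : 0 < δ) : δ ^ 2 ≤ tubeVol δ := by
  rw [tubeVol_eq hδ.le]
  exact le_vol_segTube hδ _ (by simp)

theorem tubeVol_le {δ : ℝ} (hδ : 0 < δ) (hδ2 : δ ≤ 1 / 2) : tubeVol δ ≤ 12 * δ ^ 2 := by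
  rw [tubeVol_eq hδ.le]
  exact vol_segTube_le hδ hδ2 _ (by simp)

theorem le_mul_of_sInf_le {S : Set ℝ} (hne : S.Nonempty) {x y M : ℝ} (hx : 0 ≤ x)
    (hS : ∀ C ∈ S, y ≤ C * x) (hM : sInf S ≤ M) : y ≤ M * x := by
  rcases hx.eq_or_lt with rfl | hx
  · obtain ⟨C, hC⟩ := hne
    simpa using hS C hC
  · rw [← div_le_iff₀ hx]
    exact (le_csInf hne fun C hC => (div_le_iff₀ hx).2 (hS C hC)).trans hM

theorem vol_nonneg (s : Set E3) : 0 ≤ vol s := ENNReal.toReal_nonneg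

theorem ncard_tubes_le_of_KTCW {δ M : ℝ} (hδ : 0 < δ) {𝕋 : Finset (Set E3)}
    (hδ2 : δ ≤ 1 / 2) (hvol : ∀ T ∈ 𝕋, δ ^ 2 ≤ vol T) (hM : KTCW δ 𝕋 ≤ M) {W : Set E3}
    (hW : Convex ℝ W) (hWb : Bornology.IsBounded W) :
    (Set.ncard {T | T ∈ 𝕋 ∧ T ⊆ W} : ℝ) ≤ M * (vol W / tubeVol δ) := by
  have hV : 0 < tubeVol δ := lt_of_lt_of_le (by positivity) (le_tubeVol hδ)
  rw [KTCW] at hM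
  refine le_mul_of_sInf_le ?_ (div_nonneg (vol_nonneg W) hV.le) (fun C hC => ?_) hM
  · refine ⟨12 * 𝕋.card + 1, by positivity, fun U _ hUb => ?_⟩
    rcases Set.eq_empty_or_nonempty {T | T ∈ 𝕋 ∧ T ⊆ U} with h0 | ⟨T, hT, hTU⟩
    · rw [h0, Set.ncard_empty, Nat.cast_zero]
      exact div_nonneg (mul_nonneg (by positivity) (vol_nonneg U)) hV.le
    · have h₁ : (Set.ncard {T | T ∈ 𝕋 ∧ T ⊆ U} : ℝ) ≤ 𝕋.card := by
        rw [← Set.ncard_coe_finset]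
        exact Nat.cast_le.2 (Set.ncard_le_ncard
          (show {T | T ∈ 𝕋 ∧ T ⊆ U} ⊆ (𝕋 : Set (Set E3)) from fun T hT => hT.1)
          𝕋.finite_toSet)
      have h₂ : δ ^ 2 ≤ vol U := (hvol T hT).trans (vol_mono hTU hUb)
      have h₃ : tubeVol δ ≤ 12 * vol U := (tubeVol_le hδ hδ2).trans (by linarith)
      refine h₁.trans ?_
      rw [le_div_iff₀ hV]
      calc (𝕋.card : ℝ) * tubeVol δ ≤ 𝕋.card * (12 * vol U) := by gcongr
        _ ≤ (12 * 𝕋.card + 1) * vol U := by linarith [vol_nonneg U]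
  · rw [← mul_div_assoc]
    exact hC.2 W hW hWb

theorem ncard_tubes_le_of_FSW {δ M : ℝ} (hδ : 0 < δ) {𝕋 : Finset (Set E3)}
    (hvol : ∀ T ∈ 𝕋, δ ^ 2 ≤ vol T) (hM : FSW 𝕋 ≤ M) {W : Set E3} (hW : IsSlab W) :
    (Set.ncard {T | T ∈ 𝕋 ∧ T ⊆ W} : ℝ) ≤ M * (vol W * 𝕋.card) := by
  rw [FSW] at hM
  refine le_mul_of_sInf_le ?_ (mul_nonneg (vol_nonneg W) (Nat.cast_nonneg _))
    (fun C hC => ?_) hM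
  · refine ⟨1 / δ ^ 2, by positivity, fun U hU => ?_⟩
    have hUb : Bornology.IsBounded U := by
      obtain ⟨H, r, -, -, -, rfl⟩ := hU
      exact isBounded_closedBall.subset inter_subset_left
    rcases Set.eq_empty_or_nonempty {T | T ∈ 𝕋 ∧ T ⊆ U} with h0 | ⟨T, hT, hTU⟩
    · rw [h0, Set.ncard_empty, Nat.cast_zero]
      exact mul_nonneg (mul_nonneg (by positivity) (vol_nonneg U)) (Nat.cast_nonneg _)
    · have h₁ : (Set.ncard {T | T ∈ 𝕋 ∧ T ⊆ U} : ℝ) ≤ 𝕋.card := by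
        rw [← Set.ncard_coe_finset]
        exact Nat.cast_le.2 (Set.ncard_le_ncard
          (show {T | T ∈ 𝕋 ∧ T ⊆ U} ⊆ (𝕋 : Set (Set E3)) from fun T hT => hT.1)
          𝕋.finite_toSet)
      have h₂ : 1 ≤ 1 / δ ^ 2 * vol U := by
        rw [one_div_mul_eq_div, le_div_iff₀ (by positivity), one_mul]
        exact (hvol T hT).trans (vol_mono hTU hUb)
      exact h₁.trans (le_mul_of_one_le_left (Nat.cast_nonneg _) h₂)
  · rw [← mul_assoc]
    exact hC.2 W hW

theorem exists_isWolffFamily {δ τ : ℝ} (hδ : 0 < δ) (hδ2 : δ ≤ 1 / 2) (hτ : 0 < τ)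
    {𝕋 : Finset (Set E3)} {Y : Set E3 → Set E3} (h : TubePair δ 𝕋 Y) (hd : ShadingDense τ 𝕋 Y)
    (hK : KTCW δ 𝕋 ≤ τ⁻¹) (hF : FSW 𝕋 ≤ τ⁻¹) :
    ∃ a e : 𝕋 → E3, IsWolffFamily δ τ a e fun T => Y T.1 := by
  choose a e he hT using fun T : 𝕋 => (h.1 T.1 T.2).1.exists_eq_segTube hδ.le
  have hvol : ∀ T ∈ 𝕋, δ ^ 2 ≤ vol T := fun T hmem => by
    rw [show T = _ from hT ⟨T, hmem⟩]
    exact le_vol_segTube hδ _ (he _)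
  have hcard : ∀ (W : Set E3) (L : Finset 𝕋), (∀ i ∈ L, segTube δ (a i) (e i) ⊆ W) →
      (L.card : ℝ) ≤ Set.ncard {T | T ∈ 𝕋 ∧ T ⊆ W} := by
    intro W L hL
    rw [← Finset.card_map (Function.Embedding.subtype _), ← Set.ncard_coe_finset]
    refine Nat.cast_le.2 (Set.ncard_le_ncard (fun T hTL => ?_)
      (𝕋.finite_toSet.subset fun T hT => hT.1))
    obtain ⟨i, hi, rfl⟩ := Finset.mem_map.1 (Finset.mem_coe.1 hTL)
    exact ⟨i.2, (hT i).subset.trans (hL i hi)⟩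
  refine ⟨a, e, he, fun T => ?_, fun T => ?_, fun T => (h.1 T.1 T.2).2.2.2, ?_, ?_, ?_⟩
  · rw [← hT T]
    exact (h.1 T.1 T.2).2.1
  · rw [← hT T]
    exact (h.1 T.1 T.2).2.2.1
  · rw [Finset.sum_coe_sort 𝕋 fun T => vol (Y T), Fintype.card_coe]
    refine le_trans ?_ hd
    rw [mul_assoc]
    refine mul_le_mul_of_nonneg_left ?_ hτ.le
    rw [← nsmul_eq_mul]
    exact Finset.card_nsmul_le_sum _ _ _ hvol
  · intro W L hW hWb hL
    refine ((hcard W L hL).trans (ncard_tubes_le_of_KTCW hδ hδ2 hvol hK hW hWb)).trans ?_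
    rw [mul_div_assoc]
    have := vol_nonneg W
    have := le_tubeVol hδ
    gcongr
  · intro W L hW hL
    refine ((hcard W L hL).trans (ncard_tubes_le_of_FSW hδ hvol hF hW)).trans (le_of_eq ?_)
    rw [Fintype.card_coe, mul_assoc]

theorem exists_hairbrush_bound (ε : ℝ) (hε : 0 < ε) :
    ∃ κ : ℝ, 0 < κ ∧ ∃ η : ℝ, 0 < η ∧ ∀ δ : ℝ, 0 < δ →
      ∀ (𝕋 : Finset (Set E3)) (Y : Set E3 → Set E3),
        TubePair δ 𝕋 Y → ShadingDense (δ ^ η) 𝕋 Y →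
        KTCW δ 𝕋 ≤ δ ^ (-η) → FSW 𝕋 ≤ δ ^ (-η) →
        κ * δ ^ ((3 : ℝ) / 2 + ε) * (𝕋.card : ℝ) ^ ((1 : ℝ) / 2)
          ≤ vol (⋃ T ∈ 𝕋, Y T) := by
  obtain ⟨m, hm⟩ := exists_nat_ge (6 / ε)
  have hη : (0 : ℝ) < 1 / (m + 2 : ℕ) := by positivity
  obtain ⟨C, hC, hbound⟩ := IsWolffFamily.exists_volume_sq_bound m
  refine ⟨√C, Real.sqrt_pos.2 hC, 1 / (m + 2 : ℕ), hη, ?_⟩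
  intro δ hδ 𝕋 Y h hd hK hF
  rcases 𝕋.eq_empty_or_nonempty with rfl | ⟨T₀, hT₀⟩
  · rw [Finset.card_empty, Nat.cast_zero, Real.zero_rpow (by norm_num), mul_zero]
    exact vol_nonneg _
  have hδ2 : δ ≤ 1 / 2 := by
    obtain ⟨a, e, he, rfl⟩ := (h.1 T₀ hT₀).1.exists_eq_segTube hδ.le
    exact le_half_of_segTube_subset_ball hδ.le he (h.1 _ hT₀).2.1
  rw [Real.rpow_neg hδ.le] at hK hF
  set τ : ℝ := δ ^ ((1 : ℝ) / (m + 2 : ℕ)) with hτdef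
  have hτ : 0 < τ := Real.rpow_pos_of_pos hδ _
  have hτ1 : τ ≤ 1 := Real.rpow_le_one hδ.le (by linarith) hη.le
  have hδτ : τ ^ (m + 2) = δ := by
    rw [hτdef, one_div, Real.rpow_inv_natCast_pow hδ.le (by omega)]
  obtain ⟨a, e, hfam⟩ := exists_isWolffFamily hδ hδ2 hτ h hd hK hF
  have key := hbound hτ hτ1 (by rwa [hδτ]) (by rwa [hδτ])
  rw [hδτ, Fintype.card_coe, show (⋃ i : 𝕋, Y i.1) = ⋃ T ∈ 𝕋, Y T from
    (Set.biUnion_eq_iUnion (𝕋 : Set (Set E3)) fun T _ => Y T).symm] at key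
  refine le_of_sq_le_sq ?_ (vol_nonneg _)
  refine le_trans ?_ key
  have hexp : δ ^ ((3 : ℝ) / 2 + ε) ≤ δ ^ ((3 : ℝ) / 2) * τ ^ 6 := by
    rw [hτdef, ← Real.rpow_natCast, ← Real.rpow_mul hδ.le, ← Real.rpow_add hδ]
    refine Real.rpow_le_rpow_of_exponent_ge hδ (by linarith) ?_
    rw [div_le_iff₀ hε] at hm
    have : (1 : ℝ) / (m + 2 : ℕ) * (6 : ℕ) ≤ ε := by
      rw [div_mul_eq_mul_div, div_le_iff₀ (by positivity)]
      push_cast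
      nlinarith
    linarith
  have hδ3 : (δ ^ ((3 : ℝ) / 2)) ^ 2 = δ ^ 3 := by
    rw [← Real.rpow_natCast, ← Real.rpow_mul hδ.le, ← Real.rpow_natCast δ 3]
    norm_num
  calc (√C * δ ^ ((3 : ℝ) / 2 + ε) * (𝕋.card : ℝ) ^ ((1 : ℝ) / 2)) ^ 2
      ≤ (√C * (δ ^ ((3 : ℝ) / 2) * τ ^ 6) * (𝕋.card : ℝ) ^ ((1 : ℝ) / 2)) ^ 2 := by gcongr
    _ = √C ^ 2 * (√(𝕋.card : ℝ) ^ 2 * (δ ^ ((3 : ℝ) / 2)) ^ 2 * τ ^ 12) := by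
        rw [← Real.sqrt_eq_rpow]; ring
    _ = _ := by rw [Real.sq_sqrt hC.le, Real.sq_sqrt (Nat.cast_nonneg _), hδ3]

theorem assertD_half_zero : AssertD (1 / 2) 0 := by
  intro ε hε
  obtain ⟨κ, hκ, η, hη, hbound⟩ := exists_hairbrush_bound ε hε
  refine ⟨κ / 12, by positivity, η, hη, fun δ hδ 𝕋 Y h hd hK hF => ?_⟩
  refine le_trans ?_ (hbound δ hδ 𝕋 Y h hd hK hF)
  rcases 𝕋.eq_empty_or_nonempty with rfl | ⟨T₀, hT₀⟩
  · simp
  have hδ2 : δ ≤ 1 / 2 := by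
    obtain ⟨a, e, he, rfl⟩ := (h.1 T₀ hT₀).1.exists_eq_segTube hδ.le
    exact le_half_of_segTube_subset_ball hδ.le he (h.1 _ hT₀).2.1
  have hN : (0 : ℝ) < 𝕋.card := Nat.cast_pos.2 (Finset.card_pos.2 ⟨T₀, hT₀⟩)
  have hV : 0 < tubeVol δ := lt_of_lt_of_le (by positivity) (le_tubeVol hδ)
  set N : ℝ := (𝕋.card : ℝ)
  set V := tubeVol δ
  have hpow : (N * V) * (N * V ^ ((1 : ℝ) / 2)) ^ (-((1 : ℝ) / 2))
      = N ^ ((1 : ℝ) / 2) * V ^ ((3 : ℝ) / 4) := by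
    rw [Real.mul_rpow hN.le (by positivity), ← Real.rpow_mul hV.le]
    calc _ = (N ^ (1 : ℝ) * N ^ (-((1 : ℝ) / 2))) * (V ^ (1 : ℝ) * V ^ ((1 : ℝ) / 2 * -(1 / 2))) := by
          rw [Real.rpow_one, Real.rpow_one]; ring
      _ = _ := by
          rw [← Real.rpow_add hN, ← Real.rpow_add hV]; norm_num
  have hVδ : V ^ ((3 : ℝ) / 4) ≤ 12 * δ ^ ((3 : ℝ) / 2) := by
    calc V ^ ((3 : ℝ) / 4) ≤ (12 * δ ^ 2) ^ ((3 : ℝ) / 4) :=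
          Real.rpow_le_rpow hV.le (tubeVol_le hδ hδ2) (by norm_num)
      _ = 12 ^ ((3 : ℝ) / 4) * δ ^ ((3 : ℝ) / 2) := by
          rw [Real.mul_rpow (by norm_num) (by positivity), ← Real.rpow_natCast δ 2,
            ← Real.rpow_mul hδ.le]
          norm_num
      _ ≤ 12 ^ (1 : ℝ) * δ ^ ((3 : ℝ) / 2) := by
          gcongr <;> norm_num
      _ = _ := by rw [Real.rpow_one]
  rw [mul_assoc, hpow, zero_add, Real.rpow_add hδ]
  calc κ / 12 * δ ^ ε * (N ^ ((1 : ℝ) / 2) * V ^ ((3 : ℝ) / 4))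
      ≤ κ / 12 * δ ^ ε * (N ^ ((1 : ℝ) / 2) * (12 * δ ^ ((3 : ℝ) / 2))) := by gcongr
    _ = _ := by ring

/-- Proposition 1.7 (Wolff's hairbrush bound): for all `ε > 0` there exist `κ, η > 0` such
that every `δ^η`-dense pair `(𝕋, Y)_δ` with Katz–Tao Convex Wolff constant and Frostman
Slab Wolff constant at most `δ^{-η}` satisfies
`|⋃ Y(T)| ≥ κ·δ^{3/2+ε}·(#𝕋)^{1/2}`.  In particular, Assertion `𝒟(1/2, 0)` is true. -/
theorem wolff_hairbrush :
    (∀ ε : ℝ, 0 < ε → ∃ κ : ℝ, 0 < κ ∧ ∃ η : ℝ, 0 < η ∧ ∀ δ : ℝ, 0 < δ →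
      ∀ (𝕋 : Finset (Set E3)) (Y : Set E3 → Set E3),
        TubePair δ 𝕋 Y → ShadingDense (δ ^ η) 𝕋 Y →
        KTCW δ 𝕋 ≤ δ ^ (-η) → FSW 𝕋 ≤ δ ^ (-η) →
        κ * δ ^ ((3 : ℝ) / 2 + ε) * (𝕋.card : ℝ) ^ ((1 : ℝ) / 2)
          ≤ vol (⋃ T ∈ 𝕋, Y T)) ∧
    AssertD (1 / 2) 0 := by
  exact ⟨exists_hairbrush_bound, assertD_half_zero⟩

end
end

section
/- For every n ≥ 1 there is a constant K_n depending only on n with the following property. Let U ⊆ ℝⁿ be a bounded convex set with 0 < |U| < ∞, let H ⊆ ℝⁿ be a hyperplane, and let s > 0 and t ∈ (0, 1]. If |U ∩ N_s(H)| = t·|U|, then U ⊆ N_{K_n·s/t}(H). -/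
open MeasureTheory Metric Set

noncomputable section

abbrev En (n : ℕ) : Type := EuclideanSpace ℝ (Fin n)

/-- The Lebesgue volume of a subset of `ℝⁿ`, as a real number. -/
def voln {n : ℕ} (s : Set (En n)) : ℝ := (MeasureTheory.volume s).toReal

/-- A hyperplane of `ℝⁿ`: a nonempty affine subspace whose direction has dimension
`n - 1`. -/
def IsHyperplane {n : ℕ} (H : AffineSubspace ℝ (En n)) : Prop :=
  (H : Set (En n)).Nonempty ∧ Module.finrank ℝ H.direction = n - 1

/-- The distance to an affine subspace `H` is the norm of the component orthogonal to `H`. -/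
theorem mem_cthickening_iff_norm_starProjection_le {n : ℕ} (H : AffineSubspace ℝ (En n))
    {p : En n} (hp : p ∈ H) {r : ℝ} (hr : 0 ≤ r) {x : En n} :
    x ∈ cthickening r (H : Set (En n)) ↔ ‖H.directionᗮ.starProjection (x - p)‖ ≤ r := by
  constructor
  · intro h
    rw [H.closed_of_finiteDimensional.cthickening_eq_biUnion_closedBall hr] at h
    simp only [mem_iUnion, mem_closedBall] at h
    obtain ⟨y, hy, hxy⟩ := h
    have hdir : H.directionᗮ.starProjection (y - p) = 0 := by
      rw [Submodule.starProjection_apply_eq_zero_iff, Submodule.orthogonal_orthogonal]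
      exact AffineSubspace.vsub_mem_direction hy hp
    have hsub : x - p = (x - y) + (y - p) := by abel
    rw [hsub, map_add, hdir, add_zero]
    exact (Submodule.norm_starProjection_apply_le _ _).trans (by rwa [← dist_eq_norm])
  · intro h
    refine mem_cthickening_of_dist_le x (H.direction.starProjection (x - p) + p) r _ ?_ ?_
    · exact AffineSubspace.vadd_mem_of_mem_direction
        (Submodule.starProjection_apply_mem _ _) hp
    · rw [Submodule.starProjection_orthogonal_val] at h
      rw [dist_eq_norm, ← sub_sub, sub_right_comm]
      exact h

/-- If a convex set `U` contains `x`, then the slab `‖P (y - p)‖ ≤ s` around `p` cannot carry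
much of the volume of `U` when `P (x - p)` is large compared with `s`: contracting the slab
towards `x` by ratios between `1 / 2` and `1` yields many disjoint pieces of `U`. -/
theorem Convex.floor_mul_volume_slab_le {n : ℕ} {U : Set (En n)} (hU : Convex ℝ U)
    (P : En n →L[ℝ] En n) (p : En n) {s : ℝ} (hs : 0 < s) (hfin : volume U ≠ ⊤) {x : En n}
    (hx : x ∈ U) :
    (⌊‖P (x - p)‖ / (6 * s)⌋₊ : ℝ) * (volume (U ∩ {y | ‖P (y - p)‖ ≤ s})).toReal ≤
      2 ^ n * (volume U).toReal := by
  set h := ‖P (x - p)‖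
  set m := ⌊h / (6 * s)⌋₊
  set V := U ∩ {y | ‖P (y - p)‖ ≤ s}
  rcases Nat.eq_zero_or_pos m with hm | hm
  · rw [hm, Nat.cast_zero, zero_mul]
    positivity
  have hmh : (m : ℝ) * (6 * s) ≤ h := by
    rw [← le_div_iff₀ (by positivity)]
    exact Nat.floor_le (by positivity)
  have hm1 : (1 : ℝ) ≤ m := by exact_mod_cast hm
  have hh : 0 < h := by nlinarith
  let c : ℕ → ℝ := fun k => k * (3 * s / h)
  have hc0 : ∀ k, 0 ≤ c k := fun k => by positivity
  have hc : ∀ k < m, c k ≤ 1 / 2 := by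
    intro k hk
    have hk' : (k : ℝ) ≤ m := by exact_mod_cast hk.le
    simp only [c]
    rw [← mul_div_assoc, div_le_iff₀ hh]
    nlinarith
  let B : ℕ → Set (En n) := fun k => {y | ‖P (y - p) - c k • P (x - p)‖ ≤ s}
  have hBm : ∀ k, MeasurableSet (B k) := fun k =>
    (isClosed_le (by fun_prop) continuous_const).measurableSet
  have hBd : Pairwise (Function.onFun Disjoint B) := by
    intro j k hjk
    refine Set.disjoint_left.2 fun y hj hk => ?_
    have hdist : ‖(c j - c k) • P (x - p)‖ ≤ s + s := by
      have heq : (c j - c k) • P (x - p) =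
          (P (y - p) - c k • P (x - p)) - (P (y - p) - c j • P (x - p)) := by
        rw [sub_smul]
        abel
      rw [heq]
      exact (norm_sub_le _ _).trans (add_le_add hk hj)
    have hone : (1 : ℝ) ≤ |(j : ℝ) - k| := by
      have hne : (j : ℤ) - k ≠ 0 := sub_ne_zero.2 (by exact_mod_cast hjk)
      exact_mod_cast Int.one_le_abs hne
    have hnorm : ‖(c j - c k) • P (x - p)‖ = |(j : ℝ) - k| * (3 * s) := by
      rw [norm_smul, Real.norm_eq_abs, ← sub_mul, abs_mul,
        abs_of_pos (by positivity : 0 < 3 * s / h), mul_assoc]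
      congr 1
      exact div_mul_cancel₀ _ hh.ne'
    nlinarith
  have hpiece : ∀ k < m, ENNReal.ofReal ((1 / 2) ^ n) * volume V ≤ volume (B k ∩ U) := by
    intro k hk
    have hck := hc k hk
    have hsub : AffineMap.homothety x (1 - c k) '' V ⊆ B k ∩ U := by
      rintro _ ⟨y, ⟨hyU, hy⟩, rfl⟩
      have hval : AffineMap.homothety x (1 - c k) y = c k • x + (1 - c k) • y := by
        rw [AffineMap.homothety_apply, vsub_eq_sub, vadd_eq_add]
        module
      rw [hval]
      refine ⟨?_, hU hx hyU (hc0 k) (by linarith) (by ring)⟩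
      have hlin : P (c k • x + (1 - c k) • y - p) - c k • P (x - p) =
          (1 - c k) • P (y - p) := by
        rw [← map_smul, ← map_smul, ← map_sub]
        congr 1
        module
      change ‖_‖ ≤ s
      rw [hlin, norm_smul, Real.norm_of_nonneg (by linarith)]
      exact (mul_le_of_le_one_left (norm_nonneg _) (by linarith [hc0 k])).trans hy
    refine le_trans ?_ (measure_mono hsub)
    rw [Measure.addHaar_image_homothety, finrank_euclideanSpace_fin]
    gcongr
    exact (pow_le_pow_left₀ (by norm_num) (by linarith) n).trans (le_abs_self _)
  have hsum : (m : ENNReal) * (ENNReal.ofReal ((1 / 2) ^ n) * volume V) ≤ volume U := by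
    calc (m : ENNReal) * (ENNReal.ofReal ((1 / 2) ^ n) * volume V)
        = ∑ _k ∈ Finset.range m, ENNReal.ofReal ((1 / 2) ^ n) * volume V := by simp
      _ ≤ ∑ k ∈ Finset.range m, volume.restrict U (B k) := by
          refine Finset.sum_le_sum fun k hk => ?_
          rw [Measure.restrict_apply (hBm k)]
          exact hpiece k (Finset.mem_range.1 hk)
      _ = volume.restrict U (⋃ k ∈ Finset.range m, B k) :=
          (measure_biUnion_finset (fun _ _ _ _ hne => hBd hne) fun k _ => hBm k).symm
      _ ≤ volume.restrict U univ := measure_mono (subset_univ _)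
      _ = volume U := Measure.restrict_apply_univ U
  have hreal := ENNReal.toReal_mono hfin hsum
  rw [ENNReal.toReal_mul, ENNReal.toReal_mul, ENNReal.toReal_natCast,
    ENNReal.toReal_ofReal (by positivity)] at hreal
  calc (m : ℝ) * (volume V).toReal
      = 2 ^ n * (m * ((1 / 2) ^ n * (volume V).toReal)) := by
        rw [one_div, inv_pow]
        field_simp
    _ ≤ _ := by gcongr

/-- Lemma 2.10 (a consequence of Brunn's theorem): there is a constant `K_n`, depending
only on `n`, such that any bounded convex set `U ⊆ ℝⁿ` of positive volume with
`|U ∩ N_s(H)| = t·|U|` for a hyperplane `H`, `s > 0` and `t ∈ (0, 1]`, satisfies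
`U ⊆ N_{K_n·s/t}(H)`. -/
theorem convex_concentration_near_hyperplane (n : ℕ) (hn : 1 ≤ n) :
    ∃ K : ℝ, 0 < K ∧
      ∀ (U : Set (En n)) (H : AffineSubspace ℝ (En n)) (s t : ℝ),
        Convex ℝ U → Bornology.IsBounded U → 0 < voln U →
        IsHyperplane H →
        0 < s → 0 < t → t ≤ 1 →
        voln (U ∩ Metric.cthickening s (H : Set (En n))) = t * voln U →
        U ⊆ Metric.cthickening (K * s / t) (H : Set (En n)) := by
  refine ⟨6 * (2 ^ n + 1), by positivity, ?_⟩
  intro U H s t hU _ hvol hH hs ht ht1 heq x hx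
  obtain ⟨p, hp⟩ := hH.1
  rw [mem_cthickening_iff_norm_starProjection_le H hp (by positivity)]
  set P := H.directionᗮ.starProjection
  have hV : U ∩ cthickening s (H : Set (En n)) = U ∩ {y | ‖P (y - p)‖ ≤ s} := by
    ext y
    simp only [mem_inter_iff, mem_cthickening_iff_norm_starProjection_le H hp hs.le, P,
      mem_ofPred_eq]
  rw [hV] at heq
  have hfin : volume U ≠ ⊤ := fun h => by simp [voln, h] at hvol
  have hcount := hU.floor_mul_volume_slab_le P p hs hfin hx
  have hslab : (volume (U ∩ {y | ‖P (y - p)‖ ≤ s})).toReal = t * (volume U).toReal := heq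
  have hle : (⌊‖P (x - p)‖ / (6 * s)⌋₊ : ℝ) * t ≤ 2 ^ n := by
    rw [hslab] at hcount
    refine le_of_mul_le_mul_right ?_ hvol
    calc _ = _ := mul_assoc _ _ _
      _ ≤ _ := hcount
  have hfloor := Nat.lt_floor_add_one (‖P (x - p)‖ / (6 * s))
  rw [div_lt_iff₀ (by positivity)] at hfloor
  rw [le_div_iff₀ ht]
  nlinarith

end
end
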